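/- arXiv:math/0612263 — 3 statements merged into one kernel-verified Lean document; each statement's English description precedes it below -/
import Mathlib

section
/- If α ∈ K_v is algebraic over K (i.e., α is a root of a nonzero polynomial with coefficients in K), then α is separable over K (i.e., α is a root of a separable polynomial with coefficients in K). -/
section

open Polynomial

namespace RatFunc

theorem X_mul_inv_X_pow_succ {k : Type*} [Field k] (j : ℕ) :
    X * (X : RatFunc k)⁻¹ ^ (j + 1) = X⁻¹ ^ j := by
  rw [pow_succ', mul_inv_cancel_left₀ X_ne_zero]

section infty

variable {k : Type*} [Field k] [DecidableEq (RatFunc k)]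

theorem inftyValuation_algebraMap_ne_zero {c : k} (hc : c ≠ 0) :
    inftyValuation k (algebraMap k (RatFunc k) c) = 1 :=
  inftyValuation.C k hc

theorem inftyValuation_algebraMap_polynomial {p : k[X]} (hp : p ≠ 0) :
    inftyValuation k (algebraMap k[X] (RatFunc k) p) = WithZero.exp (p.natDegree : ℤ) :=
  inftyValuation.polynomial k hp

theorem exists_inftyValuation_sub_lt_one (f : RatFunc k) (hf : inftyValuation k f ≤ 1) :
    ∃ c : k, inftyValuation k (f - algebraMap k (RatFunc k) c) < 1 := by
  rcases hf.lt_or_eq with h | h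
  · exact ⟨0, by simpa using h⟩
  have hf0 : f ≠ 0 := by
    rintro rfl
    simp at h
  have hn : f.num ≠ 0 := num_ne_zero hf0
  have hd : f.denom ≠ 0 := f.denom_ne_zero
  have hd' : algebraMap k[X] (RatFunc k) f.denom ≠ 0 := by simpa using hd
  have hdeg : f.num.natDegree = f.denom.natDegree := by
    rw [inftyValuation_apply, inftyValuation_of_nonzero k hf0, ← WithZero.exp_zero,
      WithZero.exp_inj, intDegree] at h
    omega
  set c := f.num.leadingCoeff with hc
  have hc0 : c ≠ 0 := leadingCoeff_ne_zero.mpr hn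
  have hlt : (f.num - Polynomial.C c * f.denom).degree < f.num.degree := by
    apply degree_sub_lt_left _ hn
    · simp [(monic_denom f).leadingCoeff, hc]
    · rw [degree_C_mul hc0, degree_eq_natDegree hn, degree_eq_natDegree hd, hdeg]
  refine ⟨c, ?_⟩
  have hfe : (f - algebraMap k (RatFunc k) c) * algebraMap k[X] (RatFunc k) f.denom =
      algebraMap k[X] (RatFunc k) (f.num - Polynomial.C c * f.denom) := by
    rw [map_sub, map_mul, sub_mul, ← (div_eq_iff hd').mp (num_div_denom f)]
    rfl
  rcases eq_or_ne (f.num - Polynomial.C c * f.denom) 0 with h0 | h0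
  · rw [h0, map_zero, mul_eq_zero, or_iff_left hd'] at hfe
    rw [hfe, map_zero]
    exact zero_lt_one
  · have := congrArg (inftyValuation k) hfe
    rw [map_mul, inftyValuation_algebraMap_polynomial h0,
      inftyValuation_algebraMap_polynomial hd] at this
    have hlt' := natDegree_lt_natDegree h0 hlt
    by_contra! hge
    have h2 := mul_le_mul_left hge (WithZero.exp (f.denom.natDegree : ℤ))
    rw [this, one_mul, WithZero.exp_le_exp] at h2
    omega

theorem inftyValuation_X_mul_le_one {f : RatFunc k} (hf : inftyValuation k f < 1) :
    inftyValuation k (X * f) ≤ 1 := by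
  rw [map_mul, inftyValuation.X]
  rcases eq_or_ne f 0 with rfl | h
  · simp
  · rw [inftyValuation_apply, inftyValuation_of_nonzero k h] at hf ⊢
    rw [← WithZero.exp_zero, WithZero.exp_lt_exp] at hf
    rw [← WithZero.exp_zero, ← WithZero.exp_add, WithZero.exp_le_exp]
    omega

theorem inftyValuation_inv_X_pow_le_one (r : ℕ) :
    inftyValuation k ((X : RatFunc k)⁻¹ ^ r) ≤ 1 := by
  rw [map_pow, map_inv₀, inftyValuation.X]
  refine pow_le_one' ?_ r
  rw [← WithZero.exp_neg, ← WithZero.exp_zero, WithZero.exp_le_exp]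
  decide

variable {L : Type*} [Field L] [Algebra (RatFunc k) L]

theorem isIntegral_valuationSubring_smul {f : RatFunc k} (hf : inftyValuation k f ≤ 1) {z : L}
    (hz : IsIntegral (inftyValuation k).valuationSubring z) :
    IsIntegral (inftyValuation k).valuationSubring (f • z) :=
  hz.smul (⟨f, hf⟩ : (inftyValuation k).valuationSubring)

theorem exists_isIntegral_inv_X_pow_smul [FiniteDimensional (RatFunc k) L] (y : L) :
    ∃ c : ℕ, ∀ r ≥ c, IsIntegral (inftyValuation k).valuationSubring
      ((X : RatFunc k)⁻¹ ^ r • y) := by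
  obtain ⟨d, hd, hy⟩ := ((IsFractionRing.isAlgebraic_iff (inftyValuation k).valuationSubring
    (RatFunc k) L).mpr (Algebra.IsAlgebraic.isAlgebraic y)).exists_integral_multiple
  have hd0 : (d : RatFunc k) ≠ 0 := by simpa using hd
  refine ⟨(-intDegree (d : RatFunc k)).toNat, fun r hr ↦ ?_⟩
  have : (X : RatFunc k)⁻¹ ^ r • y = ((X : RatFunc k)⁻¹ ^ r * (d : RatFunc k)⁻¹) • (d • y) := by
    rw [mul_smul]
    congr 1
    exact (inv_smul_smul₀ hd0 y).symm
  rw [this]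
  refine isIntegral_valuationSubring_smul ?_ hy
  rw [map_mul, map_pow, map_inv₀, map_inv₀, inftyValuation.X, inftyValuation_apply,
    inftyValuation_of_nonzero k hd0, ← WithZero.exp_neg, ← WithZero.exp_neg,
    ← WithZero.exp_nsmul, ← WithZero.exp_add, ← WithZero.exp_zero, WithZero.exp_le_exp]
  simp only [nsmul_eq_mul]
  omega

variable [Algebra k[X] L] [IsScalarTower k[X] (RatFunc k) L]

theorem eq_zero_of_isIntegral_of_isIntegral_X_smul {y : L} (hy : IsIntegral k[X] y)
    (hy' : IsIntegral (inftyValuation k).valuationSubring ((X : RatFunc k) • y)) : y = 0 := by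
  have h1 := minpoly.isIntegrallyClosed_eq_field_fractions' (RatFunc k) hy
  have h2 := minpoly.isIntegrallyClosed_eq_field_fractions' (RatFunc k) hy'
  have hyF : IsIntegral (RatFunc k) y := hy.tower_top
  by_contra hy0
  rw [IsIntegrallyClosed.minpoly_smul X_ne_zero hyF] at h2
  have hc := minpoly.coeff_zero_ne_zero hyF hy0
  have hd := minpoly.natDegree_pos hyF
  have hp : (minpoly k[X] y).coeff 0 ≠ 0 := by
    intro h
    rw [h1, coeff_map, h, map_zero] at hc
    exact hc rfl
  have h3 : inftyValuation k (((minpoly (RatFunc k) y).scaleRoots X).coeff 0) ≤ 1 := by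
    rw [h2, coeff_map]
    exact ((minpoly (inftyValuation k).valuationSubring ((X : RatFunc k) • y)).coeff 0).2
  rw [coeff_scaleRoots, map_mul, map_pow, inftyValuation.X, h1, coeff_map,
    inftyValuation_algebraMap_polynomial hp, ← h1, ← WithZero.exp_nsmul, ← WithZero.exp_add,
    ← WithZero.exp_zero, WithZero.exp_le_exp] at h3
  simp only [Nat.sub_zero, nsmul_eq_mul, mul_one] at h3
  omega

variable [Algebra k L] [IsScalarTower k k[X] L]

variable (k L) in
/-- The elements of `L` that are integral over `k[X]` and have poles of order less than `j`
(measured in terms of `X`) at the places above infinity. -/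
def integralOfPoleLT (j : ℕ) : Submodule k L where
  carrier := {y | IsIntegral k[X] y ∧
    IsIntegral (inftyValuation k).valuationSubring ((X * (X : RatFunc k)⁻¹ ^ j) • y)}
  add_mem' := fun ha hb ↦ ⟨ha.1.add hb.1, by rw [smul_add]; exact ha.2.add hb.2⟩
  zero_mem' := ⟨isIntegral_zero, by rw [smul_zero]; exact isIntegral_zero⟩
  smul_mem' := fun c y hy ↦ by
    refine ⟨?_, ?_⟩
    · rw [← algebraMap_smul k[X] c y]
      exact hy.1.smul _
    · rw [← algebraMap_smul k[X] c y, ← algebraMap_smul (RatFunc k) (algebraMap k k[X] c) y,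
        smul_comm]
      refine isIntegral_valuationSubring_smul ?_ hy.2
      rcases eq_or_ne c 0 with rfl | hc
      · simp
      · exact (inftyValuation_algebraMap_ne_zero hc).le

theorem integralOfPoleLT_zero : integralOfPoleLT k L 0 = ⊥ := by
  rw [eq_bot_iff]
  rintro y ⟨h1, h2⟩
  rw [pow_zero, mul_one] at h2
  exact eq_zero_of_isIntegral_of_isIntegral_X_smul h1 h2

theorem integralOfPoleLT_le_succ (j : ℕ) :
    integralOfPoleLT k L j ≤ integralOfPoleLT k L (j + 1) := by
  rintro y ⟨h1, h2⟩
  refine ⟨h1, ?_⟩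
  have := isIntegral_valuationSubring_smul (inftyValuation_inv_X_pow_le_one 1) h2
  rwa [pow_one, ← mul_smul, mul_left_comm, ← pow_succ'] at this

theorem rank_integralOfPoleLT_succ_le [FiniteDimensional (RatFunc k) L] (j : ℕ) :
    Module.rank k (integralOfPoleLT k L (j + 1)) ≤
      Module.finrank (RatFunc k) L + Module.rank k (integralOfPoleLT k L j) := by
  have : IsScalarTower k (RatFunc k) L := .to₁₃₄ k k[X] (RatFunc k) L
  rw [← Submodule.rank_quotient_add_rank
    ((integralOfPoleLT k L j).submoduleOf (integralOfPoleLT k L (j + 1))),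
    (Submodule.submoduleOfEquivOfLe (integralOfPoleLT_le_succ j)).rank_eq]
  gcongr
  refine rank_le fun s hs ↦ ?_
  by_contra! hcard
  choose z hz using Submodule.Quotient.mk_surjective
    ((integralOfPoleLT k L j).submoduleOf (integralOfPoleLT k L (j + 1)))
  have hdep : ¬ LinearIndependent (RatFunc k) fun i : s ↦ (z i : L) := fun h ↦ by
    have := h.fintype_card_le_finrank
    rw [Fintype.card_coe] at this
    omega
  obtain ⟨g, hg, i₀, hi₀⟩ := Fintype.not_linearIndependent_iff.mp hdep
  obtain ⟨i, -, hi⟩ := Finset.exists_max_image Finset.univ (fun i ↦ inftyValuation k (g i))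
    ⟨i₀, Finset.mem_univ _⟩
  have hgi : g i ≠ 0 := by
    intro h
    have := hi i₀ (Finset.mem_univ _)
    rw [h, map_zero, le_zero_iff, map_eq_zero] at this
    exact hi₀ this
  have hle (a : s) : inftyValuation k ((g i)⁻¹ * g a) ≤ 1 := by
    rw [map_mul, map_inv₀]
    have h0 : 0 < inftyValuation k (g i) := by simpa [zero_lt_iff] using hgi
    rw [inv_mul_le_iff₀ h0, mul_one]
    exact hi a (Finset.mem_univ _)
  choose c hc using fun a ↦ exists_inftyValuation_sub_lt_one _ (hle a)
  have hci : c i ≠ 0 := by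
    intro h
    have := hc i
    rw [h, map_zero, sub_zero, inv_mul_cancel₀ hgi, map_one] at this
    exact lt_irrefl _ this
  have hsum : ∑ a, ((g i)⁻¹ * g a) • (z a : L) = 0 := by
    simp_rw [mul_smul, ← Finset.smul_sum, hg, smul_zero]
  have hmem : ∑ a, c a • (z a : L) ∈ integralOfPoleLT k L j := by
    refine ⟨((integralOfPoleLT k L (j + 1)).sum_mem
      fun a _ ↦ Submodule.smul_mem _ (c a) (z a).2).1, ?_⟩
    have : ∑ a, c a • (z a : L) =
        -∑ a, ((g i)⁻¹ * g a - algebraMap k (RatFunc k) (c a)) • (z a : L) := by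
      simp_rw [sub_smul, Finset.sum_sub_distrib, hsum, algebraMap_smul, zero_sub, neg_neg]
    rw [this, smul_neg, Finset.smul_sum]
    refine (IsIntegral.sum _ fun a _ ↦ ?_).neg
    rw [← mul_smul, mul_right_comm, mul_smul]
    refine isIntegral_valuationSubring_smul (inftyValuation_X_mul_le_one (hc a)) ?_
    rw [← X_mul_inv_X_pow_succ]
    exact (z a).2.2
  refine hci (Fintype.linearIndependent_iff.mp hs c ?_ i)
  have : ∑ a, c a • (a : integralOfPoleLT k L (j + 1) ⧸
      (integralOfPoleLT k L j).submoduleOf (integralOfPoleLT k L (j + 1))) =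
      Submodule.Quotient.mk (∑ a, c a • z a) := by
    rw [← Submodule.mkQ_apply, map_sum]
    simp [hz]
  rw [this, Submodule.Quotient.mk_eq_zero]
  refine Submodule.mem_comap.mpr ?_
  simpa using hmem

theorem rank_integralOfPoleLT_le [FiniteDimensional (RatFunc k) L] (j : ℕ) :
    Module.rank k (integralOfPoleLT k L j) ≤ (j * Module.finrank (RatFunc k) L : ℕ) := by
  induction j with
  | zero => simp [integralOfPoleLT_zero]
  | succ j ih =>
    refine (rank_integralOfPoleLT_succ_le j).trans ((add_le_add_right ih _).trans ?_)
    rw [add_mul, one_mul, add_comm]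
    push_cast
    rfl

omit [DecidableEq (RatFunc k)] in
theorem linearIndependent_X_pow : LinearIndependent k fun i : ℕ ↦ (X : RatFunc k) ^ i := by
  have := (basisMonomials k).linearIndependent.map' (IsScalarTower.toAlgHom k k[X] (RatFunc k)).toLinearMap
    (LinearMap.ker_eq_bot.mpr (IsFractionRing.injective k[X] (RatFunc k)))
  have h : (fun i : ℕ ↦ (X : RatFunc k) ^ i) =
      (IsScalarTower.toAlgHom k k[X] (RatFunc k)).toLinearMap ∘ basisMonomials k := by
    funext i
    simp [← X_pow_eq_monomial]
  rwa [h]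

omit [DecidableEq (RatFunc k)] [Algebra k L] [IsScalarTower k k[X] L] in
theorem X_pow_smul_eq (i : ℕ) (y : L) :
    (X : RatFunc k) ^ i • y = ((Polynomial.X : k[X]) ^ i) • y := by
  rw [← algebraMap_smul (RatFunc k) ((Polynomial.X : k[X]) ^ i) y]
  simp

theorem X_pow_smul_mem_integralOfPoleLT {u : L} (hu : IsIntegral k[X] u) {i r : ℕ} (hi : i ≤ r)
    (h : IsIntegral (inftyValuation k).valuationSubring ((X : RatFunc k)⁻¹ ^ (r - i) • u)) :
    (X : RatFunc k) ^ i • u ∈ integralOfPoleLT k L (r + 1) := by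
  refine ⟨?_, ?_⟩
  · rw [X_pow_smul_eq]
    exact hu.smul _
  · rw [X_mul_inv_X_pow_succ, ← mul_smul]
    have : (X : RatFunc k)⁻¹ ^ r * X ^ i = X⁻¹ ^ (r - i) := by
      conv_lhs => rw [← Nat.sub_add_cancel hi]
      rw [pow_add, mul_assoc, ← mul_pow, inv_mul_cancel₀ X_ne_zero, one_pow, mul_one]
    rwa [this]

variable (k L) in
/-- The integral closure of `k[X]` in a finite extension of `k(X)`, separable or not, is a finite
`k[X]`-module. -/
theorem fg_integralClosure [FiniteDimensional (RatFunc k) L] :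
    (integralClosure k[X] L).toSubmodule.FG := by
  have : IsScalarTower k (RatFunc k) L := .to₁₃₄ k k[X] (RatFunc k) L
  obtain ⟨ι, u, hu⟩ := FiniteDimensional.exists_is_basis_integral k[X] (RatFunc k) L
  set n := Module.finrank (RatFunc k) L with hn
  have hcard : Fintype.card ι = n := (Module.finrank_eq_card_basis u).symm
  choose c hc using fun i ↦ exists_isIntegral_inv_X_pow_smul (k := k) (u i)
  obtain ⟨c₀, hc₀⟩ : ∃ c₀, ∀ i, c i ≤ c₀ :=
    ⟨Finset.univ.sup c, fun i ↦ Finset.le_sup (Finset.mem_univ i)⟩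
  set M : Submodule k[X] L := Submodule.span k[X] (Set.range u) with hM
  have hMC : M ≤ (integralClosure k[X] L).toSubmodule := by
    rw [hM, Submodule.span_le]
    rintro _ ⟨i, rfl⟩
    exact hu i
  have hMfg : M.FG := Submodule.fg_span (Set.finite_range u)
  refine Submodule.fg_of_fg_map_of_fg_inf_ker M.mkQ ?_ ?_
  swap
  · rwa [Submodule.ker_mkQ, inf_eq_right.mpr hMC]
  set Q := (integralClosure k[X] L).toSubmodule.map M.mkQ with hQ
  suffices h : Module.rank k Q ≤ ((c₀ + 1) * n : ℕ) by
    have : Module.Finite k Q := Module.rank_lt_aleph0_iff.mp (h.trans_lt Cardinal.natCast_lt_aleph0)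
    have : Module.Finite k[X] Q := .of_restrictScalars_finite k k[X] Q
    exact Module.Finite.iff_fg.mp this
  refine rank_le fun s hs ↦ ?_
  have hlift (q : Q) : ∃ y : L, IsIntegral k[X] y ∧ M.mkQ y = q := by
    obtain ⟨y, hy, h⟩ := q.2
    exact ⟨y, hy, h⟩
  choose y hyint hyq using hlift
  choose d hd using fun i ↦ exists_isIntegral_inv_X_pow_smul (k := k) (y i)
  set r := c₀ + s.sup d with hr
  have hyW (q : Q) (hq : q ∈ s) : y q ∈ integralOfPoleLT k L (r + 1) := by
    refine ⟨hyint q, ?_⟩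
    rw [X_mul_inv_X_pow_succ]
    exact hd q r (le_add_left (Finset.le_sup hq))
  have : Module.Finite k (integralOfPoleLT k L (r + 1)) := Module.rank_lt_aleph0_iff.mp
    ((rank_integralOfPoleLT_le (r + 1)).trans_lt Cardinal.natCast_lt_aleph0)
  have hW : Module.finrank k (integralOfPoleLT k L (r + 1)) ≤ (r + 1) * n :=
    Module.finrank_le_of_rank_le (rank_integralOfPoleLT_le (r + 1))
  let g : integralOfPoleLT k L (r + 1) →ₗ[k] L ⧸ M :=
    (M.mkQ.restrictScalars k) ∘ₗ (integralOfPoleLT k L (r + 1)).subtype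
  have hrange : s.card ≤ Module.finrank k g.range := by
    let w : s → g.range := fun q ↦ ⟨q.1, ⟨y q.1, hyW q.1 q.2⟩, hyq q.1⟩
    have hw : LinearIndependent k w := by
      apply LinearIndependent.of_comp g.range.subtype
      exact hs.map' (Q.subtype.restrictScalars k) (LinearMap.ker_eq_bot.mpr Subtype.val_injective)
    simpa using hw.fintype_card_le_finrank
  have hker : (s.sup d) * n ≤ Module.finrank k g.ker := by
    have hmem (p : Fin (s.sup d) × ι) :
        (X : RatFunc k) ^ (p.1 : ℕ) • u p.2 ∈ integralOfPoleLT k L (r + 1) := by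
      have hlt := p.1.2
      refine X_pow_smul_mem_integralOfPoleLT (hu p.2) (by omega) (hc _ _ ((hc₀ _).trans ?_))
      omega
    have hmemM (p : Fin (s.sup d) × ι) : (X : RatFunc k) ^ (p.1 : ℕ) • u p.2 ∈ M := by
      rw [X_pow_smul_eq]
      exact M.smul_mem _ (Submodule.subset_span ⟨_, rfl⟩)
    let w : Fin (s.sup d) × ι → g.ker := fun p ↦
      ⟨⟨_, hmem p⟩, (Submodule.Quotient.mk_eq_zero M).mpr (hmemM p)⟩
    have hw : LinearIndependent k w := by
      have hw₀ : LinearIndependent k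
          fun p : Fin (s.sup d) × ι ↦ (X : RatFunc k) ^ (p.1 : ℕ) • u p.2 :=
        linearIndependent_smul (linearIndependent_X_pow.comp _ Fin.val_injective)
          u.linearIndependent
      apply LinearIndependent.of_comp g.ker.subtype
      apply LinearIndependent.of_comp (integralOfPoleLT k L (r + 1)).subtype
      exact hw₀
    simpa [hcard] using hw.fintype_card_le_finrank
  have hrn := g.finrank_range_add_finrank_ker
  have : (r + 1) * n = (c₀ + 1) * n + (s.sup d) * n := by
    rw [hr]
    ring
  omega

end infty

end RatFunc

namespace Valuation

variable {Γ : Type*} [LinearOrderedCommGroupWithZero Γ]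

theorem le_one_of_isIntegral {A L : Type*} [CommRing A] [Field L] [Algebra A L]
    (v : Valuation L Γ) (hA : ∀ a : A, v (algebraMap A L a) ≤ 1) {b : L} (hb : IsIntegral A b) :
    v b ≤ 1 := by
  have h : IsIntegral v.valuationSubring b :=
    hb.map_of_comp_eq ((algebraMap A L).codRestrict v.valuationSubring.toSubring hA)
      (RingHom.id L) rfl
  obtain ⟨y, rfl⟩ := IsIntegrallyClosed.isIntegral_iff.mp h
  exact y.2

theorem exists_isIntegral_mul_of_aeval_eq_zero {A E : Type*} [CommRing A] [Field E] [Algebra A E]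
    (v : Valuation E Γ) (hA : ∀ a : A, v (algebraMap A E a) ≤ 1) {z : E} (hz : v z ≤ 1)
    (P : (integralClosure A E)[X]) (hP : aeval z P = 0) {i : ℕ} (hi : v (P.coeff i : E) = 1) :
    ∃ s : E, IsIntegral A s ∧ v s = 1 ∧ IsIntegral A (s * z) := by
  induction hn : P.natDegree using Nat.strong_induction_on generalizing P i with
  | _ n ih =>
    have hint : IsIntegral A ((P.leadingCoeff : E) * z) :=
      isIntegral_trans (A := integralClosure A E) _ (isIntegral_leadingCoeff_smul P z hP)
    have hle := v.le_one_of_isIntegral hA P.leadingCoeff.2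
    rcases hle.lt_or_eq with hlt | heq
    swap
    · exact ⟨_, P.leadingCoeff.2, heq, hint⟩
    have hin : i < n := by
      have h1 : i ≤ n := by
        rw [← hn]
        refine le_natDegree_of_ne_zero fun h ↦ ?_
        simp [h] at hi
      refine h1.lt_of_ne ?_
      rintro rfl
      rw [← hn] at hi
      exact hlt.ne hi
    obtain ⟨m, rfl⟩ : ∃ m, n = m + 1 := ⟨n - 1, by omega⟩
    let c : integralClosure A E := ⟨_, hint⟩
    have hdeg : (P.eraseLead + C c * X ^ m).natDegree < m + 1 := by
      refine Nat.lt_succ_of_le (natDegree_add_le_of_degree_le ?_ (natDegree_C_mul_X_pow_le c m))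
      have := eraseLead_natDegree_le P
      omega
    refine ih _ hdeg (P.eraseLead + C c * X ^ m) ?_ (i := i) ?_ rfl
    · rw [← eraseLead_add_C_mul_X_pow P, hn] at hP
      rw [← hP]
      simp only [map_add, map_mul, aeval_C, aeval_X, map_pow, pow_succ']
      rw [← mul_assoc]
      rfl
    · rw [coeff_add, eraseLead_coeff_of_ne _ (by omega), coeff_C_mul, coeff_X_pow]
      split_ifs
      · rw [mul_one]
        rw [← hi]
        refine v.map_add_eq_of_lt_left ?_
        rw [hi]
        change v (P.leadingCoeff * z) < 1
        rw [map_mul]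
        exact mul_lt_one_of_lt_of_le hlt hz
      · simpa using hi

section

variable {k E : Type*} [Field k] [Field E] [Algebra k[X] E] (v : Valuation E Γ)

theorem algebraMap_polynomial_eq_one (hk : ∀ c : k, c ≠ 0 → v (algebraMap k[X] E (C c)) = 1)
    (hX : v (algebraMap k[X] E X) < 1) {a : k[X]} (ha : a.coeff 0 ≠ 0)
    (hle : ∀ a : k[X], v (algebraMap k[X] E a) ≤ 1) : v (algebraMap k[X] E a) = 1 := by
  rw [← X_mul_divX_add a, map_add, map_mul, ← hk _ ha]
  refine v.map_add_eq_of_lt_right ?_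
  rw [hk _ ha, map_mul]
  exact mul_lt_one_of_lt_of_le hX (hle _)

theorem algebraMap_polynomial_le_one (hk : ∀ c : k, c ≠ 0 → v (algebraMap k[X] E (C c)) = 1)
    (hX : v (algebraMap k[X] E X) < 1) (a : k[X]) : v (algebraMap k[X] E a) ≤ 1 := by
  induction a using Polynomial.induction_on' with
  | add p q hp hq =>
    rw [map_add]
    exact v.map_add_le hp hq
  | monomial n c =>
    rw [← C_mul_X_pow_eq_monomial, map_mul, map_pow, map_mul, map_pow]
    refine mul_le_one' ?_ (pow_le_one' hX.le n)
    rcases eq_or_ne c 0 with rfl | hc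
    · simp
    · exact (hk c hc).le

theorem exists_isIntegral_mul [Algebra.IsAlgebraic k[X] E]
    [Module.IsTorsionFree k[X] E]
    (hk : ∀ c : k, c ≠ 0 → v (algebraMap k[X] E (C c)) = 1)
    (hX : v (algebraMap k[X] E X) < 1) {z : E} (hz : v z ≤ 1) :
    ∃ s : E, IsIntegral k[X] s ∧ v s = 1 ∧ IsIntegral k[X] (s * z) := by
  have hle := v.algebraMap_polynomial_le_one hk hX
  obtain ⟨_⟩ : Nonempty (NormalizedGCDMonoid k[X]) := inferInstance
  obtain ⟨P, hP0, hP⟩ := Algebra.IsAlgebraic.isAlgebraic (R := k[X]) z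
  have hprim := P.isPrimitive_primPart
  have hroot : aeval z P.primPart = 0 := aeval_primPart_eq_zero hP0 hP
  obtain ⟨i, hi⟩ : ∃ i, (P.primPart.coeff i).coeff 0 ≠ 0 := by
    by_contra! h
    exact not_isUnit_X (hprim X (C_dvd_iff_dvd_coeff _ _ |>.mpr fun i ↦ X_dvd_iff.mpr (h i)))
  refine v.exists_isIntegral_mul_of_aeval_eq_zero hle hz
    (P.primPart.map (algebraMap k[X] (integralClosure k[X] E))) ?_ (i := i) ?_
  · rwa [aeval_map_algebraMap]
  · rw [coeff_map]
    exact v.algebraMap_polynomial_eq_one hk hX hi hle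

end

theorem mem_range_algebraMap_of_pow_mem {k E L : Type*} [Field k] [Field E] [Field L]
    [Algebra k[X] E] [Algebra k L] [Algebra k[X] L] [Algebra (RatFunc k) L] [Algebra E L]
    [IsScalarTower k k[X] L] [IsScalarTower k[X] (RatFunc k) L] [IsScalarTower k[X] E L]
    [FiniteDimensional (RatFunc k) L] (v : Valuation L Γ)
    (hk : ∀ c : k, c ≠ 0 → v (algebraMap k L c) = 1) (hX : v (algebraMap k[X] L X) < 1)
    (p : ℕ) [Fact p.Prime] [CharP L p] {α : L} (hα : α ^ p ∈ (algebraMap E L).range)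
    (hdense : ∀ t : E, t ≠ 0 → ∃ a : E, v (α - algebraMap E L a) ≤ v (algebraMap E L t)) :
    α ∈ (algebraMap E L).range := by
  classical
  by_contra hmem
  have hinj : Function.Injective (algebraMap k[X] L) := by
    rw [IsScalarTower.algebraMap_eq k[X] (RatFunc k) L]
    exact (algebraMap (RatFunc k) L).injective.comp (IsFractionRing.injective k[X] (RatFunc k))
  have hinjE : Function.Injective (algebraMap k[X] E) := by
    rw [IsScalarTower.algebraMap_eq k[X] E L, RingHom.coe_comp] at hinj
    exact hinj.of_comp
  have : Module.IsTorsionFree k[X] E := Module.isTorsionFree_iff_algebraMap_injective.mpr hinjE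
  have : Algebra.IsAlgebraic k[X] L :=
    (IsFractionRing.comap_isAlgebraic_iff (K := RatFunc k)).mpr inferInstance
  have : Algebra.IsAlgebraic k[X] E :=
    ⟨fun z ↦ (isAlgebraic_algebraMap_iff (algebraMap E L).injective).mp
      (Algebra.IsAlgebraic.isAlgebraic (R := k[X]) (algebraMap E L z))⟩
  have hk' (c : k) (hc : c ≠ 0) : v (algebraMap k[X] L (C c)) = 1 := by
    rw [← Polynomial.algebraMap_eq, ← IsScalarTower.algebraMap_apply k k[X] L]
    exact hk c hc
  have hone : α ∉ (1 : Submodule E L) := fun h ↦ by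
    obtain ⟨a, ha⟩ := Submodule.mem_one.mp h
    exact hmem ⟨a, ha⟩
  obtain ⟨f, hf, hker⟩ := Submodule.exists_le_ker_of_notMem hone
  obtain ⟨w, hw⟩ := RatFunc.fg_integralClosure k L
  obtain ⟨e, he, hint⟩ := Algebra.IsAlgebraic.exists_integral_multiples k[X] (w.image f)
  have hfint (y : L) (hy : IsIntegral k[X] y) : IsIntegral k[X] (e • f y) := by
    have : y ∈ Submodule.span k[X] (w : Set L) := hw ▸ hy
    clear hy
    induction this using Submodule.span_induction with
    | mem y hy => exact hint _ (Finset.mem_image_of_mem f hy)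
    | zero => simpa using isIntegral_zero
    | add x y _ _ hx hy =>
      rw [map_add, smul_add]
      exact hx.add hy
    | smul a x _ hx =>
      rw [← algebraMap_smul E a x, map_smul, algebraMap_smul, smul_comm]
      exact hx.smul a
  set t : E := algebraMap k[X] E X * algebraMap k[X] E e * f α with ht
  have ht0 : t ≠ 0 := by
    refine mul_ne_zero (mul_ne_zero ?_ ?_) hf
    · exact (map_ne_zero_iff _ hinjE).mpr X_ne_zero
    · exact (map_ne_zero_iff _ hinjE).mpr he
  obtain ⟨a, ha⟩ := hdense t ht0
  set y : L := t⁻¹ • (α - algebraMap E L a) with hy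
  have hfa : f (algebraMap E L a) = 0 := hker (Submodule.mem_one.mpr ⟨a, rfl⟩)
  have hfy : f y = t⁻¹ * f α := by
    rw [hy, map_smul, _root_.map_sub, hfa, sub_zero, smul_eq_mul]
  have hvy : v y ≤ 1 := by
    have hvt : 0 < v (algebraMap E L t) := by simpa [zero_lt_iff] using ht0
    rw [hy, Algebra.smul_def, map_mul, map_inv₀, map_inv₀, inv_mul_le_iff₀ hvt, mul_one]
    exact ha
  obtain ⟨z, hz⟩ : y ^ p ∈ (algebraMap E L).range := by
    rw [hy, Algebra.smul_def, mul_pow, sub_pow_char, ← map_pow, ← map_pow]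
    exact mul_mem ⟨_, rfl⟩ (sub_mem hα ⟨_, rfl⟩)
  obtain ⟨s, hs, hvs, hsz⟩ := (v.comap (algebraMap E L)).exists_isIntegral_mul (k := k) (z := z)
    (fun c hc ↦ by
      rw [comap_apply, ← IsScalarTower.algebraMap_apply]
      exact hk' c hc)
    (by rwa [comap_apply, ← IsScalarTower.algebraMap_apply])
    (by
      rw [comap_apply, hz, map_pow]
      exact pow_le_one' hvy p)
  have hsy : IsIntegral k[X] (s • y) := by
    have hp : 0 < p := (Fact.out : p.Prime).pos
    refine IsIntegral.of_pow hp ?_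
    have : (s • y) ^ p = algebraMap E L (s ^ (p - 1) * (s * z)) := by
      rw [← mul_assoc, ← pow_succ, Nat.sub_add_cancel hp, Algebra.smul_def, mul_pow, map_mul, hz,
        map_pow]
    rw [this]
    exact ((hs.pow _).mul hsz).algebraMap
  have h1 := hfint _ hsy
  have h2 : e • f (s • y) * algebraMap k[X] E X = s := by
    rw [map_smul, hfy, Algebra.smul_def, smul_eq_mul]
    have : algebraMap k[X] E e * (s * (t⁻¹ * f α)) * algebraMap k[X] E X = s * (t⁻¹ * t) := by
      rw [ht]
      ring
    rw [this, inv_mul_cancel₀ ht0, mul_one]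
  have h3 := (v.comap (algebraMap E L)).le_one_of_isIntegral (fun a ↦ by
    rw [comap_apply, ← IsScalarTower.algebraMap_apply]
    exact v.algebraMap_polynomial_le_one hk' hX a) h1
  have h4 : (v.comap (algebraMap E L)) s < 1 := by
    rw [← h2, map_mul, mul_comm]
    refine mul_lt_one_of_lt_of_le ?_ h3
    rwa [comap_apply, ← IsScalarTower.algebraMap_apply]
  exact h4.ne hvs

theorem isSeparable_of_dense {k K Ω : Type*} [Field k] [Field K] [Field Ω]
    [Algebra k K] [Algebra k[X] K] [Algebra (RatFunc k) K]
    [Algebra k Ω] [Algebra k[X] Ω] [Algebra (RatFunc k) Ω] [Algebra K Ω]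
    [IsScalarTower k K Ω] [IsScalarTower k[X] K Ω] [IsScalarTower (RatFunc k) K Ω]
    [IsScalarTower k k[X] K] [IsScalarTower k[X] (RatFunc k) K]
    [FiniteDimensional (RatFunc k) K] (v : Valuation Ω Γ)
    (hk : ∀ c : k, c ≠ 0 → v (algebraMap k Ω c) = 1) (hX : v (algebraMap k[X] Ω X) < 1)
    (hdense : ∀ β t : Ω, t ≠ 0 → ∃ a : K, v (β - algebraMap K Ω a) ≤ v t)
    {α : Ω} (hα : IsIntegral K α) : IsSeparable K α := by
  let L := IntermediateField.adjoin K {α}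
  let g : L := IntermediateField.AdjoinSimple.gen K α
  have : FiniteDimensional K L := IntermediateField.adjoin.finiteDimensional hα
  have : FiniteDimensional (RatFunc k) L := .trans (RatFunc k) K L
  have : IsScalarTower k k[X] L := .to₁₂₄ k k[X] K L
  have : IsScalarTower k[X] (RatFunc k) L := .to₁₂₄ k[X] (RatFunc k) K L
  have : IsScalarTower k L Ω := .of_algebraMap_eq fun c ↦ by
    rw [IsScalarTower.algebraMap_apply k K Ω, IsScalarTower.algebraMap_apply k K L,
      ← IsScalarTower.algebraMap_apply K L Ω]
  have : IsScalarTower k[X] L Ω := .of_algebraMap_eq fun c ↦ by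
    rw [IsScalarTower.algebraMap_apply k[X] K Ω, IsScalarTower.algebraMap_apply k[X] K L,
      ← IsScalarTower.algebraMap_apply K L Ω]
  let E := separableClosure K L
  have : IsPurelyInseparable E L := separableClosure.isPurelyInseparable K L
  have : IsScalarTower k[X] E L := .to₁₃₄ k[X] K E L
  have hg : g ∈ (algebraMap E L).range := by
    obtain ⟨q, hq⟩ := ExpChar.exists E
    obtain ⟨n, hn⟩ := IsPurelyInseparable.pow_mem E q g
    cases hq with
    | zero => simpa using hn
    | prime hp =>
      have : Fact q.Prime := ⟨hp⟩
      have : CharP L q := charP_of_injective_algebraMap (algebraMap E L).injective q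
      induction n with
      | zero => simpa using hn
      | succ n ih =>
        refine ih ((v.comap (algebraMap L Ω)).mem_range_algebraMap_of_pow_mem (k := k) ?_ ?_ q
          (by rwa [← pow_mul, ← pow_succ]) fun t ht ↦ ?_)
        · intro c hc
          rw [comap_apply, ← IsScalarTower.algebraMap_apply]
          exact hk c hc
        · rwa [comap_apply, ← IsScalarTower.algebraMap_apply]
        · obtain ⟨a, ha⟩ := hdense (algebraMap L Ω (g ^ q ^ n)) (algebraMap L Ω (algebraMap E L t))
            (by simpa using ht)
          refine ⟨algebraMap K E a, ?_⟩
          rwa [comap_apply, comap_apply, _root_.map_sub, ← IsScalarTower.algebraMap_apply K E L,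
            ← IsScalarTower.algebraMap_apply K L Ω]
  obtain ⟨e, he⟩ := hg
  have hsep : IsSeparable K g := by
    rw [← he]
    exact mem_separableClosure_iff.mp e.2
  rwa [IsSeparable, IntermediateField.minpoly_gen] at hsep

theorem exists_separable_eval₂_eq_zero {k K Ω : Type*} [Field k] [Field K] [Field Ω]
    [Algebra k K] [Algebra k[X] K] [Algebra (RatFunc k) K]
    [IsScalarTower k k[X] K] [IsScalarTower k[X] (RatFunc k) K]
    [FiniteDimensional (RatFunc k) K] (i : K →+* Ω) (v : Valuation Ω Γ)
    (hk : ∀ c : k, c ≠ 0 → v (i (algebraMap k K c)) = 1) (hX : v (i (algebraMap k[X] K X)) < 1)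
    (hdense : ∀ β t : Ω, t ≠ 0 → ∃ a : K, v (β - i a) ≤ v t)
    {α : Ω} (hα : ∃ f : K[X], f ≠ 0 ∧ f.eval₂ i α = 0) :
    ∃ f : K[X], f.Separable ∧ f.eval₂ i α = 0 := by
  let : Algebra K Ω := i.toAlgebra
  let : Algebra k Ω := (i.comp (algebraMap k K)).toAlgebra
  let : Algebra k[X] Ω := (i.comp (algebraMap k[X] K)).toAlgebra
  let : Algebra (RatFunc k) Ω := (i.comp (algebraMap (RatFunc k) K)).toAlgebra
  have : IsScalarTower k K Ω := .of_algebraMap_eq fun _ ↦ rfl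
  have : IsScalarTower k[X] K Ω := .of_algebraMap_eq fun _ ↦ rfl
  have : IsScalarTower (RatFunc k) K Ω := .of_algebraMap_eq fun _ ↦ rfl
  have h : IsSeparable K α :=
    v.isSeparable_of_dense hk hX hdense (IsAlgebraic.isIntegral hα)
  exact ⟨minpoly K α, h, minpoly.aeval K α⟩

end Valuation

theorem Transcendental.isAlgebraic_of_not_algebraicIndependent {k K : Type*} [Field k] [Field K]
    [Algebra k K] [Algebra k[X] K] [IsScalarTower k k[X] K]
    (hX : Transcendental k (algebraMap k[X] K X)) {y : K}
    (h : ¬ AlgebraicIndependent k ![algebraMap k[X] K X, y]) : IsAlgebraic k[X] y := by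
  by_contra hy
  refine h ?_
  have h1 : AlgebraicIndependent k fun _ : Unit ↦ algebraMap k[X] K X :=
    (algebraicIndependent_unique_type_iff).mpr hX
  have h2 : AlgebraicIndependent k[X] fun _ : Unit ↦ y :=
    (algebraicIndependent_unique_type_iff).mpr hy
  have h3 := h1.sumElim_of_tower (S := k[X]) (by rintro _ ⟨_, rfl⟩; exact ⟨X, rfl⟩) h2
  have h4 := h3.comp ![Sum.inr (), Sum.inl ()] (by
    intro i j
    fin_cases i <;> fin_cases j <;> simp)
  convert h4 using 1
  ext i
  fin_cases i <;> rfl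

theorem RatFunc.finiteDimensional_of_adjoin_eq_top {k K : Type*} [Field k] [Field K]
    [Algebra k K] [Algebra k[X] K] [Algebra (RatFunc k) K] [IsScalarTower k k[X] K]
    [IsScalarTower k[X] (RatFunc k) K] {s : Finset K}
    (hs : IntermediateField.adjoin k (s : Set K) = ⊤) (halg : ∀ y ∈ s, IsAlgebraic k[X] y) :
    FiniteDimensional (RatFunc k) K := by
  have : IsScalarTower k (RatFunc k) K := .to₁₃₄ k k[X] (RatFunc k) K
  have h1 : FiniteDimensional (RatFunc k) (IntermediateField.adjoin (RatFunc k) (s : Set K)) := by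
    refine IntermediateField.finiteDimensional_adjoin fun y hy ↦ ?_
    exact ((IsFractionRing.isAlgebraic_iff k[X] (RatFunc k) K).mp (halg y hy)).isIntegral
  have h2 : IntermediateField.adjoin (RatFunc k) (s : Set K) = ⊤ := by
    refine IntermediateField.restrictScalars_injective k (eq_top_iff.mpr ?_)
    rw [← hs, IntermediateField.adjoin_le_iff]
    exact IntermediateField.subset_adjoin (RatFunc k) (s : Set K)
  exact .of_surjective (IntermediateField.adjoin (RatFunc k) (s : Set K)).val.toLinearMap
    fun y ↦ ⟨⟨y, h2 ▸ IntermediateField.mem_top⟩, rfl⟩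

theorem Valued.exists_v_sub_coe_le {K Γ : Type*} [Field K] [LinearOrderedCommGroupWithZero Γ]
    [Valued K Γ] (β : UniformSpace.Completion K) {t : UniformSpace.Completion K} (ht : t ≠ 0) :
    ∃ a : K, Valued.v (β - (a : UniformSpace.Completion K)) ≤ (Valued.v t : Γ) := by
  have hnhds : {y : UniformSpace.Completion K | Valued.v (y - β) < (Valued.v t : Γ)} ∈ nhds β := by
    rw [Valued.mem_nhds]
    refine ⟨Units.mk0 (Valued.v.restrict t) (by simpa using ht), fun y hy ↦ ?_⟩
    exact Valued.v.restrict_lt_iff.mp hy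
  obtain ⟨_, ⟨a, rfl⟩, h⟩ := UniformSpace.Completion.denseRange_coe.inter_nhds_nonempty hnhds
  refine ⟨a, ?_⟩
  rw [Valuation.map_sub_swap]
  exact h.le

end

/-- Let `k` be a field and `K` a finitely generated field extension of `k`
of transcendence degree 1 in which `k` is relatively algebraically closed.  Let `v` be a
nontrivial valuation of `K` that is trivial on `k` (encoded by a `Valued` structure on `K`),
and let `K_v = UniformSpace.Completion K` be the completion of `K` at `v`.
If `α ∈ K_v` is algebraic over `K`, then `α` is separable over `K`. -/
theorem stmt_0 (k K : Type*) [Field k] [Field K] [Algebra k K]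
    {Γ : Type*} [LinearOrderedCommGroupWithZero Γ] [Valued K Γ]
    -- `K` is a finitely generated field extension of `k`:
    (hfg : ∃ s : Finset K, IntermediateField.adjoin k (s : Set K) = ⊤)
    -- `K/k` has transcendence degree 1:
    (htr1 : ∃ x : K, Transcendental k x)
    (htr2 : ∀ x y : K, ¬ AlgebraicIndependent k ![x, y])
    -- `k` is relatively algebraically closed in `K`:
    (hrac : ∀ x : K, IsAlgebraic k x → x ∈ (algebraMap k K).range)
    -- the valuation is trivial on `k`:
    (htriv : ∀ a : k, a ≠ 0 → Valued.v (algebraMap k K a) = 1)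
    -- the valuation is nontrivial:
    (hnontriv : ∃ x : K, x ≠ 0 ∧ Valued.v x ≠ 1)
    -- `α ∈ K_v` is algebraic over `K`:
    (α : UniformSpace.Completion K)
    (halg : ∃ f : Polynomial K, f ≠ 0 ∧
      Polynomial.eval₂ (UniformSpace.Completion.coeRingHom : K →+* UniformSpace.Completion K) α f = 0) :
    -- then `α` is separable over `K`:
    ∃ f : Polynomial K, f.Separable ∧
      Polynomial.eval₂ (UniformSpace.Completion.coeRingHom : K →+* UniformSpace.Completion K) α f = 0 := by
  obtain ⟨x, hx0, hx1⟩ : ∃ x : K, x ≠ 0 ∧ Valued.v x < 1 := by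
    obtain ⟨x, hx0, hx⟩ := hnontriv
    rcases hx.lt_or_gt with h | h
    · exact ⟨x, hx0, h⟩
    · exact ⟨x⁻¹, inv_ne_zero hx0, by rw [map_inv₀]; exact inv_lt_one_of_one_lt₀ h⟩
  have hxtr : Transcendental k x := fun h ↦ by
    obtain ⟨c, rfl⟩ := hrac x h
    exact hx1.ne (htriv c (by rintro rfl; simp at hx0))
  let : Algebra (Polynomial k) K := (Polynomial.aeval (R := k) x).toAlgebra
  have hinj : Function.Injective (algebraMap (Polynomial k) K) :=
    transcendental_iff_injective.mp hxtr
  let : Algebra (RatFunc k) K := (IsFractionRing.lift (K := RatFunc k) hinj).toAlgebra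
  have : IsScalarTower k (Polynomial k) K :=
    .of_algebraMap_eq fun c ↦ ((Polynomial.aeval (R := k) x).commutes c).symm
  have : IsScalarTower (Polynomial k) (RatFunc k) K :=
    .of_algebraMap_eq fun p ↦ (IsFractionRing.lift_algebraMap hinj p).symm
  have hXx : algebraMap (Polynomial k) K Polynomial.X = x := Polynomial.aeval_X x
  obtain ⟨s, hs⟩ := hfg
  have : FiniteDimensional (RatFunc k) K := RatFunc.finiteDimensional_of_adjoin_eq_top hs fun y _ ↦
    Transcendental.isAlgebraic_of_not_algebraicIndependent (by rwa [hXx]) (htr2 _ y)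
  have h := (Valued.v : Valuation (UniformSpace.Completion K) Γ).exists_separable_eval₂_eq_zero
    (k := k) (UniformSpace.Completion.coeRingHom : K →+* UniformSpace.Completion K)
    (fun c hc ↦ (Valued.valuedCompletion_apply _).trans (htriv c hc))
    (by rw [hXx]; exact (Valued.valuedCompletion_apply x).trans_lt hx1)
    (fun β t ht ↦ Valued.exists_v_sub_coe_le β ht) (α := α)
  exact h halg
end

section
/- Suppose additionally that k has characteristic p > 0 and that [K : K^p] = p, where K^p denotes the subfield {x^p : x ∈ K} of K. If α ∈ K and α ∉ K^p, then α ∉ K_v^p; moreover K_v = K_v^p(α) and [K_v : K_v^p] = p, i.e., {α} is a p-basis of K_v. -/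
namespace Valuation

open Polynomial

variable {F Γ : Type*} [Field F] [LinearOrderedCommGroupWithZero Γ]

/-- If the nonzero terms of a finite sum have pairwise distinct values, then every term is bounded
by the value of the sum. -/
theorem map_le_map_sum_of_distinct (v : Valuation F Γ) {ι : Type*} [Fintype ι] (f : ι → F)
    (hf : ∀ i j, i ≠ j → f i ≠ 0 → v (f i) ≠ v (f j)) (j : ι) : v (f j) ≤ v (∑ i, f i) := by
  classical
  obtain ⟨m, -, hm⟩ := Finset.univ.exists_max_image (fun i => v (f i)) ⟨j, Finset.mem_univ j⟩
  by_cases h0 : f m = 0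
  · have h := hm j (Finset.mem_univ j)
    rw [h0, map_zero] at h
    exact h.trans zero_le
  · rw [v.map_sum_eq_of_lt (Finset.mem_univ m)]
    · exact hm j (Finset.mem_univ j)
    · intro i hi
      refine lt_of_le_of_ne (hm i (Finset.mem_univ i)) (hf m i ?_ h0).symm
      rintro rfl
      simp at hi

/-- A field element whose value is not a `p`-th power gives terms `c i ^ p * t ^ i`, `i < p`, of
distinct values. -/
theorem map_pow_mul_pow_le_map_sum (v : Valuation F Γ) {p : ℕ} [hp : Fact p.Prime] {t : F}
    (ht : ∀ z, v t ≠ v (z ^ p)) (c : Fin p → F) (j : Fin p) :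
    v (c j ^ p * t ^ (j : ℕ)) ≤ v (∑ i, c i ^ p * t ^ (i : ℕ)) := by
  have ht0 : t ≠ 0 := by
    rintro rfl
    exact ht 0 (by rw [zero_pow hp.out.ne_zero])
  refine v.map_le_map_sum_of_distinct (fun i : Fin p => c i ^ p * t ^ (i : ℕ)) ?_ j
  intro i l hil hi0 hv
  have hci : c i ≠ 0 := fun h => hi0 (by simp [h, hp.out.ne_zero])
  have hcl : c l ≠ 0 := by
    intro h
    rw [h, zero_pow hp.out.ne_zero, zero_mul, map_zero, v.zero_iff] at hv
    exact hi0 hv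
  have hvt : v t ≠ 0 := v.ne_zero_iff.mpr ht0
  have hvi : v (c i) ≠ 0 := v.ne_zero_iff.mpr hci
  have hvl : v (c l) ≠ 0 := v.ne_zero_iff.mpr hcl
  set d : ℤ := (i : ℤ) - (l : ℤ) with hd
  have hcop : IsCoprime d (p : ℤ) := by
    rw [isCoprime_comm, (Nat.prime_iff_prime_int.mp hp.out).coprime_iff_not_dvd]
    intro hdvd
    apply hil
    have := Int.eq_zero_of_abs_lt_dvd hdvd (by rw [abs_lt]; omega)
    exact Fin.ext (by omega)
  have hd' : v t ^ d = (v (c l) / v (c i)) ^ (p : ℤ) := by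
    rw [hd, zpow_sub₀ hvt, div_zpow, div_eq_div_iff (zpow_ne_zero _ hvt) (zpow_ne_zero _ hvi)]
    simp only [zpow_natCast]
    simp only [map_mul, map_pow] at hv
    rw [mul_comm, hv]
  obtain ⟨a, b, hab⟩ := hcop
  apply ht ((c l / c i) ^ a * t ^ b)
  calc v t = v t ^ (a * d + b * p) := by rw [hab, zpow_one]
    _ = (v t ^ d) ^ a * (v t ^ b) ^ p := by
      rw [zpow_add₀ hvt, mul_comm a, zpow_mul, zpow_mul, zpow_natCast]
    _ = _ := by
      rw [hd', map_pow, map_mul, map_zpow₀, map_zpow₀, map_div₀, mul_pow, ← zpow_mul, mul_comm,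
        ← zpow_natCast (_ ^ a), ← zpow_mul, mul_comm (p : ℤ) a, mul_comm]

variable {k : Type*} [Field k] [Algebra k F]

/-- If `v` is trivial on `k` and `v x < 1`, the value of a nonzero polynomial in `x` is a power
of `v x`, with positive exponent when the constant term vanishes. -/
theorem map_aeval_eq_pow (v : Valuation F Γ) (htriv : ∀ a : k, a ≠ 0 → v (algebraMap k F a) = 1)
    {x : F} (hx : v x < 1) (f : k[X]) :
    f = 0 ∨ ∃ n : ℕ, v (aeval x f) = v x ^ n ∧ (f.coeff 0 = 0 → n ≠ 0) := by
  induction f using Polynomial.recOnHorner with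
  | M0 => exact Or.inl rfl
  | MC f a hf ha ih =>
    right
    refine ⟨0, ?_, fun h => absurd h (by simpa [hf] using ha)⟩
    have hlt : v (aeval x f) < v (algebraMap k F a) := by
      rw [htriv a ha]
      rcases ih with rfl | ⟨n, hn, hn0⟩
      · simp
      · rw [hn]
        exact pow_lt_one₀ zero_le hx (hn0 hf)
    rw [map_add, aeval_C, v.map_add_eq_of_lt_right hlt, htriv a ha, pow_zero]
  | MX f hf ih =>
    right
    obtain ⟨n, hn, -⟩ := ih.resolve_left hf
    exact ⟨n + 1, by rw [map_mul, aeval_X, map_mul, hn, pow_succ], fun _ => n.succ_ne_zero⟩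

theorem exists_map_eq_zpow_of_mem_adjoin (v : Valuation F Γ)
    (htriv : ∀ a : k, a ≠ 0 → v (algebraMap k F a) = 1)
    {x : F} (hx : v x < 1) (hx0 : x ≠ 0) {z : F} (hz : z ∈ IntermediateField.adjoin k {x})
    (hz0 : z ≠ 0) : ∃ n : ℤ, v z = v x ^ n := by
  obtain ⟨r, s, rfl⟩ := (IntermediateField.mem_adjoin_simple_iff k z).mp hz
  obtain ⟨m, hm, -⟩ := (v.map_aeval_eq_pow htriv hx r).resolve_left (by rintro rfl; simp at hz0)
  obtain ⟨n, hn, -⟩ := (v.map_aeval_eq_pow htriv hx s).resolve_left (by rintro rfl; simp at hz0)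
  exact ⟨m - n, by
    rw [map_div₀, hm, hn, zpow_sub₀ (v.ne_zero_iff.mpr hx0), zpow_natCast, zpow_natCast]⟩

/-- If `F` is finite over `k(x)` then `v y ^ N = v x` bounds `N`. -/
theorem le_finrank_adjoin_of_map_pow_eq (v : Valuation F Γ)
    (htriv : ∀ a : k, a ≠ 0 → v (algebraMap k F a) = 1)
    {x y : F} (hx : v x < 1) (hx0 : x ≠ 0) {N : ℕ} (hy : v y ^ N = v x)
    [FiniteDimensional (IntermediateField.adjoin k {x}) F] :
    N ≤ Module.finrank (IntermediateField.adjoin k {x}) F := by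
  have hN : N ≠ 0 := by
    rintro rfl
    rw [pow_zero] at hy
    exact hx.ne hy.symm
  have hvy : v y ≠ 0 := by
    intro h
    rw [h, zero_pow hN] at hy
    exact hx0 (v.zero_iff.mp hy.symm)
  have hy0 : y ≠ 0 := v.ne_zero_iff.mp hvy
  have hvy1 : v y ≠ 1 := by
    intro h
    rw [h, one_pow] at hy
    exact hx.ne hy.symm
  have hli : LinearIndependent (IntermediateField.adjoin k {x}) (fun i : Fin N => y ^ (i : ℕ)) := by
    rw [Fintype.linearIndependent_iff]
    intro g hg j
    have hle := v.map_le_map_sum_of_distinct (fun i : Fin N => g i • y ^ (i : ℕ)) ?_ j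
    · rw [hg, map_zero, le_zero_iff, v.zero_iff, smul_eq_zero] at hle
      exact hle.resolve_right (pow_ne_zero _ hy0)
    · intro i l hil hi0 hv
      have hl0 : g l • y ^ (l : ℕ) ≠ 0 := by
        rw [← v.ne_zero_iff, ← hv, v.ne_zero_iff]
        exact hi0
      have key (i : Fin N) (h : g i • y ^ (i : ℕ) ≠ 0) :
          ∃ n : ℤ, v (g i • y ^ (i : ℕ)) = v y ^ (N * n + i) := by
        have hgi : (g i : F) ≠ 0 := by
          intro h'
          apply h
          rw [IntermediateField.smul_def, h', zero_smul]
        obtain ⟨n, hn⟩ := v.exists_map_eq_zpow_of_mem_adjoin htriv hx hx0 (g i).2 hgi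
        refine ⟨n, ?_⟩
        rw [IntermediateField.smul_def, smul_eq_mul, map_mul, hn, ← hy, zpow_add₀ hvy, zpow_mul,
          zpow_natCast, zpow_natCast, map_pow]
      obtain ⟨m, hm⟩ := key i hi0
      obtain ⟨n, hn⟩ := key l hl0
      rw [hm, hn] at hv
      have h := zpow_right_injective₀ (zero_lt_iff.mpr hvy) hvy1 hv
      apply hil
      have h' : ((i : ℕ) : ℤ) % N = ((l : ℕ) : ℤ) % N := by
        rw [← Int.add_mul_emod_self_left (i : ℤ) N m, ← Int.add_mul_emod_self_left (l : ℤ) N n,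
          add_comm, h, add_comm]
      rw [Int.emod_eq_of_lt (by omega) (by omega), Int.emod_eq_of_lt (by omega) (by omega)] at h'
      exact Fin.ext (by omega)
  simpa using hli.fintype_card_le_finrank

/-- The value group of a nontrivial valuation, trivial on `k`, of a function field in one variable
over `k` is not `p`-divisible. -/
theorem exists_forall_map_ne_map_pow (v : Valuation F Γ)
    (htriv : ∀ a : k, a ≠ 0 → v (algebraMap k F a) = 1)
    (hnontriv : ∃ x : F, x ≠ 0 ∧ v x ≠ 1)
    (hfin : ∀ x : F, Transcendental k x → FiniteDimensional (IntermediateField.adjoin k {x}) F)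
    {p : ℕ} (hp : 1 < p) : ∃ t, ∀ z, v t ≠ v (z ^ p) := by
  obtain ⟨x, hx0, hx⟩ : ∃ x : F, x ≠ 0 ∧ v x < 1 := by
    obtain ⟨x, hx0, hx⟩ := hnontriv
    rcases lt_or_gt_of_ne hx with h | h
    · exact ⟨x, hx0, h⟩
    · exact ⟨x⁻¹, inv_ne_zero hx0, by rw [map_inv₀]; exact inv_lt_one_of_one_lt₀ h⟩
  have htr : Transcendental k x := by
    rw [transcendental_iff]
    intro f hf
    refine (v.map_aeval_eq_pow htriv hx f).resolve_right ?_
    rintro ⟨n, hn, -⟩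
    rw [hf, map_zero] at hn
    exact pow_ne_zero n (v.ne_zero_iff.mpr hx0) hn.symm
  have := hfin x htr
  by_contra! hdiv
  have hroot (m : ℕ) : ∃ y, v y ^ p ^ m = v x := by
    induction m with
    | zero => exact ⟨x, by simp⟩
    | succ m ih =>
      obtain ⟨y, hy⟩ := ih
      obtain ⟨z, hz⟩ := hdiv y
      exact ⟨z, by rw [pow_succ', pow_mul, ← map_pow v z, ← hz, hy]⟩
  obtain ⟨y, hy⟩ := hroot (Module.finrank (IntermediateField.adjoin k {x}) F)
  exact absurd (v.le_finrank_adjoin_of_map_pow_eq htriv hx hx0 hy) (Nat.lt_pow_self hp).not_ge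

end Valuation

/-- A field that is finitely generated of transcendence degree at most one over `k` is finite over
`k(x)` for every transcendental `x`. -/
theorem IntermediateField.finiteDimensional_adjoin_of_transcendental {k K : Type*} [Field k]
    [Field K] [Algebra k K]
    (hfg : ∃ s : Finset K, IntermediateField.adjoin k (s : Set K) = ⊤)
    (htr : ∀ x y : K, ¬ AlgebraicIndependent k ![x, y]) {x : K} (hx : Transcendental k x) :
    FiniteDimensional (IntermediateField.adjoin k {x}) K := by
  have : Algebra.EssFiniteType k K := (IntermediateField.fg_top_iff).mp hfg
  have : Algebra.EssFiniteType (IntermediateField.adjoin k {x}) K :=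
    Algebra.EssFiniteType.of_comp k _ K
  have : Algebra.IsAlgebraic (IntermediateField.adjoin k {x}) K := by
    refine ⟨fun y => ?_⟩
    by_contra hy
    apply htr y x
    have hx' : AlgebraicIndependent k (fun _ : Unit => x) :=
      algebraicIndependent_unique_type_iff.mpr hx
    have hy' : Transcendental (Algebra.adjoin k (Set.range fun _ : Unit => x)) y := by
      intro h
      rw [Set.range_const] at h
      exact hy (h.tower_top_of_subalgebra_le (IntermediateField.algebra_adjoin_le_adjoin k {x}))
    have h := (hx'.option_iff_transcendental y).mpr hy'
    convert h.comp (![none, some ()] : Fin 2 → Option Unit)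
      (by intro i j; fin_cases i <;> fin_cases j <;> simp) using 1
    ext i
    fin_cases i <;> rfl
  exact Algebra.finite_of_essFiniteType_of_isAlgebraic

section PthPowers

variable {F : Type*} [Field F] (p : ℕ) [hp : Fact p.Prime] [CharP F p]

theorem Subfield.mem_closure_range_pow_iff {x : F} :
    x ∈ Subfield.closure (Set.range fun x : F => x ^ p) ↔ x ∈ Set.range fun x : F => x ^ p := by
  have h : (Set.range fun x : F => x ^ p) = ((frobenius F p).fieldRange : Set F) := by
    ext y
    simp [frobenius_def]
  rw [h, Subfield.closure_eq, SetLike.mem_coe]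

theorem Subfield.closure_range_pow_union_singleton_eq_top
    (hdeg : Module.finrank (Subfield.closure (Set.range fun x : F => x ^ p)) F = p)
    {α : F} (hα : α ∉ Set.range fun x : F => x ^ p) :
    Subfield.closure ((Set.range fun x : F => x ^ p) ∪ {α}) = ⊤ := by
  set S := Subfield.closure (Set.range fun x : F => x ^ p) with hS
  have := IntermediateField.isSimpleOrder_of_finrank_prime S F (hdeg.symm ▸ hp.out)
  have htop : IntermediateField.adjoin S {α} = ⊤ := by
    refine (eq_bot_or_eq_top _).resolve_left fun h => hα ?_
    rw [IntermediateField.adjoin_simple_eq_bot_iff, IntermediateField.mem_bot] at h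
    obtain ⟨a, rfl⟩ := h
    exact (Subfield.mem_closure_range_pow_iff p).mp a.2
  rw [eq_top_iff]
  intro x _
  have hx : x ∈ IntermediateField.adjoin S {α} := htop ▸ IntermediateField.mem_top
  rw [← IntermediateField.mem_toSubfield, IntermediateField.adjoin_toSubfield] at hx
  refine (Subfield.closure_le.mpr ?_) hx
  refine Set.union_subset ?_ (Set.subset_union_right.trans Subfield.subset_closure)
  rintro _ ⟨a, rfl⟩
  exact Subfield.closure_mono Set.subset_union_left a.2

variable {Γ : Type*} [LinearOrderedCommGroupWithZero Γ]

theorem Valuation.linearIndependent_pow_of_map_ne_map_pow (v : Valuation F Γ) {t : F}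
    (ht : ∀ z, v t ≠ v (z ^ p)) :
    LinearIndependent (Subfield.closure (Set.range fun x : F => x ^ p))
      (fun i : Fin p => t ^ (i : ℕ)) := by
  rw [Fintype.linearIndependent_iff]
  intro g hg j
  choose c hc using fun i => (Subfield.mem_closure_range_pow_iff p).mp (g i).2
  have hle := v.map_pow_mul_pow_le_map_sum ht c j
  simp only [Subfield.smul_def, smul_eq_mul] at hg
  simp only [hc] at hle
  rw [hg, map_zero, le_zero_iff, v.zero_iff, mul_eq_zero] at hle
  refine Subtype.ext (hle.resolve_right (pow_ne_zero _ ?_))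
  rintro rfl
  exact ht 0 (by rw [zero_pow hp.out.ne_zero])

/-- In a complete valued field of characteristic `p`, the `F ^ p`-span of the powers `t ^ i`,
`i < p`, is closed if the value of `t` is not a `p`-th power. -/
theorem Valued.isClosed_range_sum_pow_mul_pow [Valued F Γ] [CompleteSpace F] {t : F}
    (ht : ∀ z : F, Valued.v t ≠ Valued.v (z ^ p)) :
    IsClosed (Set.range fun c : Fin p → F => ∑ i, c i ^ p * t ^ (i : ℕ)) := by
  let Φ : (Fin p → F) →+ F :=
    { toFun := fun c => ∑ i, c i ^ p * t ^ (i : ℕ)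
      map_zero' := by simp [hp.out.ne_zero]
      map_add' := fun a b => by simp [add_pow_char, add_mul, Finset.sum_add_distrib] }
  let w := (Valued.v : Valuation F Γ).restrict
  have htw (z : F) : w t ≠ w (z ^ p) := fun h => ht z (Valuation.restrict_inj _ |>.mp h)
  have ht0 : w t ≠ 0 := by
    intro h
    exact htw 0 (by rw [h, zero_pow hp.out.ne_zero, map_zero])
  have hΦ : Topology.IsInducing Φ := by
    rw [IsTopologicalAddGroup.isInducing_iff_nhds_zero]
    refine le_antisymm ?_ ?_
    · have h : Continuous Φ := by
        change Continuous fun c : Fin p → F => ∑ i, c i ^ p * t ^ (i : ℕ)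
        fun_prop
      exact (h.tendsto' 0 0 (map_zero Φ)).le_comap
    · rw [nhds_pi, Filter.le_pi]
      intro i s hs
      obtain ⟨γ, hγ⟩ := Valued.mem_nhds_zero.mp hs
      refine ⟨{x | w x < ((γ ^ p * Units.mk0 (w t) ht0 ^ (i : ℕ) : _ˣ) : _)},
        Valued.mem_nhds_zero.mpr ⟨_, subset_rfl⟩, ?_⟩
      intro c hc
      have hlt := (w.map_pow_mul_pow_le_map_sum htw c i).trans_lt hc
      apply hγ
      simp only [map_mul, map_pow, Units.val_mul, Units.val_pow_eq_pow_val, Units.val_mk0] at hlt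
      exact lt_of_pow_lt_pow_left₀ p zero_le
        (lt_of_mul_lt_mul_right hlt zero_le)
  have hu := AddMonoidHom.isUniformInducing_of_isInducing hΦ
  exact hu.isComplete_range.isClosed

end PthPowers

/-- In the setting of Statement 0, suppose additionally that `k` (hence `K`)
has characteristic `p > 0` and that `[K : K^p] = p`.  If `α ∈ K` and `α ∉ K^p`, then the image
`α'` of `α` in `K_v` satisfies `α' ∉ K_v^p`, `K_v = K_v^p(α')`, and `[K_v : K_v^p] = p`;
i.e. `{α'}` is a `p`-basis of `K_v`.  Here `F^p = {x^p : x ∈ F}`, viewed as the subfield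
`Subfield.closure (Set.range (· ^ p))` of `F` (in characteristic `p` the set of `p`-th powers
is already a subfield, so the closure is that set). -/
theorem stmt_1 (k K : Type*) [Field k] [Field K] [Algebra k K]
    {Γ : Type*} [LinearOrderedCommGroupWithZero Γ] [Valued K Γ]
    (p : ℕ) [Fact p.Prime] [CharP k p] [CharP K p]
    -- `K` is a finitely generated field extension of `k`:
    (hfg : ∃ s : Finset K, IntermediateField.adjoin k (s : Set K) = ⊤)
    -- `K/k` has transcendence degree 1:
    (htr1 : ∃ x : K, Transcendental k x)
    (htr2 : ∀ x y : K, ¬ AlgebraicIndependent k ![x, y])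
    -- `k` is relatively algebraically closed in `K`:
    (hrac : ∀ x : K, IsAlgebraic k x → x ∈ (algebraMap k K).range)
    -- the valuation is trivial on `k`:
    (htriv : ∀ a : k, a ≠ 0 → Valued.v (algebraMap k K a) = 1)
    -- the valuation is nontrivial:
    (hnontriv : ∃ x : K, x ≠ 0 ∧ Valued.v x ≠ 1)
    -- `[K : K^p] = p`:
    (hKdeg : Module.finrank (Subfield.closure (Set.range fun x : K => x ^ p)) K = p)
    -- `α ∈ K` and `α ∉ K^p`:
    (α : K) (hα : α ∉ Set.range fun x : K => x ^ p) :
    -- `α ∉ K_v^p`: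
    ((α : UniformSpace.Completion K) ∉
        Set.range fun x : UniformSpace.Completion K => x ^ p) ∧
    -- `K_v = K_v^p(α)`:
    Subfield.closure
        ((Set.range fun x : UniformSpace.Completion K => x ^ p) ∪ {(α : UniformSpace.Completion K)})
      = ⊤ ∧
    -- `[K_v : K_v^p] = p`:
    Module.finrank (Subfield.closure (Set.range fun x : UniformSpace.Completion K => x ^ p))
        (UniformSpace.Completion K) = p := by
  have hp : p.Prime := Fact.out
  let ι : K →+* UniformSpace.Completion K := UniformSpace.Completion.coeRingHom
  have : CharP (UniformSpace.Completion K) p := charP_of_injective_ringHom ι.injective p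
  obtain ⟨t, ht⟩ := Valued.v.exists_forall_map_ne_map_pow htriv hnontriv
    (fun x hx => IntermediateField.finiteDimensional_adjoin_of_transcendental hfg htr2 hx)
    hp.one_lt
  have ht' (z : UniformSpace.Completion K) : Valued.v (ι t) ≠ Valued.v (z ^ p) := by
    obtain ⟨r, hr⟩ := Valued.exists_coe_eq_v z
    intro h
    apply ht r
    rw [map_pow, ← hr, ← map_pow]
    exact (Valued.valuedCompletion_apply t).symm.trans h
  have hKtop := Subfield.closure_range_pow_union_singleton_eq_top p hKdeg hα
  have hα' : ι α ∉ Set.range fun x : UniformSpace.Completion K => x ^ p := by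
    intro h
    have hle : Subfield.closure ((Set.range fun x : K => x ^ p) ∪ {α}) ≤
        (Subfield.closure (Set.range fun x : UniformSpace.Completion K => x ^ p)).comap ι := by
      rw [Subfield.closure_le]
      rintro _ (⟨y, rfl⟩ | rfl)
      · exact Subfield.subset_closure ⟨ι y, (map_pow ι y p).symm⟩
      · exact Subfield.subset_closure h
    rw [hKtop] at hle
    obtain ⟨z, hz⟩ := (Subfield.mem_closure_range_pow_iff p).mp (hle (Subfield.mem_top t))
    exact ht' z (congrArg _ hz.symm)
  have hspan (x : UniformSpace.Completion K) :
      x ∈ Set.range fun c : Fin p → UniformSpace.Completion K =>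
        ∑ i, c i ^ p * ι t ^ (i : ℕ) := by
    induction x using UniformSpace.Completion.induction_on with
    | hp => exact Valued.isClosed_range_sum_pow_mul_pow p ht'
    | ih a =>
      have hne : Nonempty (Fin p) := ⟨⟨0, hp.pos⟩⟩
      have hmem : a ∈ Submodule.span (Subfield.closure (Set.range fun x : K => x ^ p))
          (Set.range fun i : Fin p => t ^ (i : ℕ)) := by
        rw [(Valued.v.linearIndependent_pow_of_map_ne_map_pow p ht).span_eq_top_of_card_eq_finrank
          (by rw [hKdeg, Fintype.card_fin])]
        exact Submodule.mem_top
      obtain ⟨g, rfl⟩ := (Submodule.mem_span_range_iff_exists_fun _).mp hmem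
      choose c hc using fun i => (Subfield.mem_closure_range_pow_iff p).mp (g i).2
      refine ⟨fun i => ι (c i), ?_⟩
      change _ = ι _
      simp only [map_sum, Subfield.smul_def, smul_eq_mul, ← hc, map_mul, map_pow]
  have hdeg : Module.finrank
      (Subfield.closure (Set.range fun x : UniformSpace.Completion K => x ^ p))
      (UniformSpace.Completion K) = p := by
    have hli := Valued.v.linearIndependent_pow_of_map_ne_map_pow p ht'
    rw [Module.finrank_eq_card_basis (Module.Basis.mk hli ?_), Fintype.card_fin]
    rintro x -
    obtain ⟨c, rfl⟩ := hspan x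
    refine (Submodule.mem_span_range_iff_exists_fun _).mpr
      ⟨fun i => ⟨c i ^ p, Subfield.subset_closure ⟨c i, rfl⟩⟩, rfl⟩
  exact ⟨hα', Subfield.closure_range_pow_union_singleton_eq_top p hdeg hα', hdeg⟩
end

section
/- Let p be a prime, let K ⊆ L be fields of characteristic p, and let B be a subset of K that is simultaneously a p-basis of K and a p-basis of L. Suppose c ∈ L is not algebraic over K. Then there exists a field extension F of L such that F is separably closed, B is a p-basis of F, and the orbit of c under the group Aut(F/K) of field automorphisms of F fixing K pointwise is infinite. -/
/-- `B` is a `p`-basis of the field `F`: the monomials `∏_{b ∈ S} b^{e_b}`, where `S` ranges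
over finite subsets of `B` and `0 ≤ e_b < p`, form a basis of `F` as a vector space over the
subfield `F^p = {x^p : x ∈ F}` (realized as `Subfield.closure (Set.range (· ^ p))`; in
characteristic `p` the set of `p`-th powers is already a subfield, so the closure is that
set). -/
def IsPBasis (p : ℕ) (F : Type*) [Field F] (B : Set F) : Prop :=
  LinearIndependent (Subfield.closure (Set.range fun x : F => x ^ p))
      (fun f : {f : B →₀ ℕ // ∀ b, f b < p} =>
        (f : B →₀ ℕ).prod fun b e => (b : F) ^ e) ∧
  Submodule.span (Subfield.closure (Set.range fun x : F => x ^ p))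
      (Set.range fun f : {f : B →₀ ℕ // ∀ b, f b < p} =>
        (f : B →₀ ℕ).prod fun b e => (b : F) ^ e) = ⊤

universe u v

open scoped TensorProduct

/-- The map sending a finitely supported family `y` to `∑ i, y i ^ p * m i`. -/
noncomputable def frobeniusComb (p : ℕ) {R ι : Type*} [CommRing R] (m : ι → R)
    (y : ι →₀ R) : R :=
  y.sum fun i r => r ^ p * m i

/-- Every element of `R` is uniquely a combination of the `m i` with `p`-th powers as
coefficients. -/
def IsFrobeniusBasis (p : ℕ) {R ι : Type*} [CommRing R] (m : ι → R) : Prop :=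
  Function.Bijective (frobeniusComb p m)

section Ring

variable (p : ℕ) [Fact p.Prime] {R ι : Type*} [CommRing R] [ExpChar R p] (m : ι → R)

/-- `frobeniusComb` as an additive homomorphism. -/
noncomputable def frobeniusCombHom : (ι →₀ R) →+ R :=
  Finsupp.liftAddHom fun i => (AddMonoidHom.mulRight (m i)).comp (frobenius R p).toAddMonoidHom

omit [Fact p.Prime] in
lemma coe_frobeniusCombHom : ⇑(frobeniusCombHom p m) = frobeniusComb p m := rfl

omit [Fact p.Prime] in
lemma frobeniusCombHom_single (i : ι) (r : R) :
    frobeniusCombHom p m (Finsupp.single i r) = r ^ p * m i :=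
  Finsupp.liftAddHom_apply_single _ _ _

variable {p m}

omit [Fact p.Prime] in
lemma IsFrobeniusBasis.eq_zero (h : IsFrobeniusBasis p m) {y : ι →₀ R}
    (hy : frobeniusComb p m y = 0) : y = 0 := by
  rw [← coe_frobeniusCombHom] at hy
  exact h.1 (by rw [← coe_frobeniusCombHom, hy, map_zero])

omit [Fact p.Prime] in
lemma isFrobeniusBasis_of (h0 : ∀ y, frobeniusComb p m y = 0 → y = 0)
    (h1 : Function.Surjective (frobeniusComb p m)) : IsFrobeniusBasis p m :=
  ⟨by rw [← coe_frobeniusCombHom] at *; exact (injective_iff_map_eq_zero _).2 h0, h1⟩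

lemma IsFrobeniusBasis.isReduced [Nonempty ι] (h : IsFrobeniusBasis p m) : IsReduced R := by
  rw [isReduced_iff_pow_one_lt p (Fact.out : p.Prime).one_lt]
  intro r hr
  have := h.eq_zero (y := Finsupp.single (Classical.arbitrary ι) r) (by
    rw [← coe_frobeniusCombHom, frobeniusCombHom_single, hr, zero_mul])
  simpa using this

variable {S J : Type*} [CommRing S] [Algebra R S] [ExpChar S p]

omit [Fact p.Prime] in
/-- If `m` is a Frobenius basis of `R`, then it is one of the `R`-algebra `S` if and only if the
`p`-th powers of an `R`-basis of `S` again form an `R`-basis. -/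
lemma IsFrobeniusBasis.algebraMap_iff (h : IsFrobeniusBasis p m) (e : Module.Basis J R S) :
    IsFrobeniusBasis p (fun i => algebraMap R S (m i)) ↔
      Function.Bijective (Finsupp.linearCombination R fun j => e j ^ p) := by
  let T : (J →₀ ι →₀ R) ≃+ (ι →₀ S) :=
    (Finsupp.curryAddEquiv.symm.trans (Finsupp.domCongr (Equiv.prodComm J ι))).trans
      (Finsupp.curryAddEquiv.trans (Finsupp.mapRange.addEquiv e.repr.symm.toAddEquiv))
  let Φ : (ι →₀ R) ≃+ R := AddEquiv.ofBijective (frobeniusCombHom p m) h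
  have hT : ∀ j i r, T (Finsupp.single j (Finsupp.single i r)) = Finsupp.single i (r • e j) := by
    intro j i r
    have h1 : Finsupp.curryAddEquiv.symm (Finsupp.single j (Finsupp.single i r)) =
        Finsupp.single (j, i) r := by
      rw [AddEquiv.symm_apply_eq]; simp
    simp [T, h1, Finsupp.domCongr]
  have key : (frobeniusCombHom p fun i => algebraMap R S (m i)).comp T.toAddMonoidHom =
      (Finsupp.linearCombination R fun j => e j ^ p).toAddMonoidHom.comp
        (Finsupp.mapRange.addEquiv Φ).toAddMonoidHom := by
    ext j i r
    have hΦ : Φ (Finsupp.single i r) = r ^ p * m i := frobeniusCombHom_single p m i r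
    change frobeniusCombHom p _ (T (Finsupp.single j (Finsupp.single i r))) =
      Finsupp.linearCombination R (fun j => e j ^ p)
        (Finsupp.mapRange Φ (map_zero Φ) (Finsupp.single j (Finsupp.single i r)))
    rw [hT, frobeniusCombHom_single, Finsupp.mapRange_single, hΦ,
      Finsupp.linearCombination_single, smul_pow, Algebra.smul_def, Algebra.smul_def, map_mul]
    ring
  have key' : ⇑(frobeniusCombHom p fun i => algebraMap R S (m i)) ∘ T =
      (Finsupp.linearCombination R fun j => e j ^ p) ∘ (Finsupp.mapRange.addEquiv Φ) :=
    congrArg DFunLike.coe key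
  rw [IsFrobeniusBasis, ← coe_frobeniusCombHom, ← T.bijective.of_comp_iff, key',
    (Finsupp.mapRange.addEquiv Φ).bijective.of_comp_iff]

end Ring

section Localize

variable {p : ℕ} [Fact p.Prime] {R F ι : Type*} [CommRing R] [ExpChar R p] [Field F] [ExpChar F p]
  {m : ι → R}

omit [ExpChar F p] [ExpChar R p] [Fact p.Prime] in
lemma map_frobeniusComb_smul (φ : R →+* F) (c : F) (y : ι →₀ R) (z : ι →₀ F)
    (h : ∀ i, z i = c * φ (y i)) (hs : z.support ⊆ y.support) (hp : p ≠ 0) :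
    frobeniusComb p (fun i => φ (m i)) z = c ^ p * φ (frobeniusComb p m y) := by
  rw [frobeniusComb, Finsupp.sum_of_support_subset z hs _ (by simp [hp]), frobeniusComb,
    Finsupp.sum, map_sum, Finset.mul_sum]
  exact Finset.sum_congr rfl fun i _ => by rw [h]; simp; ring

/-- A Frobenius basis of `R` induces one of the field `F` when `F` is the fraction field of the
quotient of `R` by an ideal which vanishes in the localization. -/
lemma IsFrobeniusBasis.map_field (h : IsFrobeniusBasis p m) (φ : R →+* F)
    (h1 : ∀ x : F, ∃ a b, φ b ≠ 0 ∧ x * φ b = φ a)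
    (h2 : ∀ r, φ r = 0 → ∃ u, φ u ≠ 0 ∧ u * r = 0) :
    IsFrobeniusBasis p (fun i => φ (m i)) := by
  have hp : p ≠ 0 := (Fact.out : p.Prime).ne_zero
  apply isFrobeniusBasis_of
  · intro z hz
    obtain ⟨b, hb, y, hy⟩ : ∃ b, φ b ≠ 0 ∧ ∃ y : ι →₀ R, ∀ i, φ (y i) = φ b * z i := by
      clear hz
      induction z using Finsupp.induction_linear with
      | zero => exact ⟨1, by simp, 0, by simp⟩
      | add f g hf hg =>
        obtain ⟨b, hb, y, hy⟩ := hf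
        obtain ⟨b', hb', y', hy'⟩ := hg
        refine ⟨b * b', by simp [hb, hb'], b' • y + b • y', fun i => ?_⟩
        simp [hy, hy']; ring
      | single i x =>
        classical
        obtain ⟨a, b, hb, hab⟩ := h1 x
        refine ⟨b, hb, Finsupp.single i a, fun j => ?_⟩
        by_cases hij : i = j
        · subst hij; simp [← hab, mul_comm]
        · simp [hij]
    have e1 : ∀ i, z i = (φ b)⁻¹ * φ (y i) := fun i => by rw [hy]; field_simp
    have e2 : z.support ⊆ y.support := fun i hi => by
      simp only [Finsupp.mem_support_iff] at *
      intro h0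
      exact hi (by rw [e1, h0]; simp)
    rw [map_frobeniusComb_smul φ _ y z e1 e2 hp] at hz
    obtain ⟨u, hu, hur⟩ := h2 _ ((mul_eq_zero.1 hz).resolve_left (by simp [hb]))
    have h3 : frobeniusComb p m (u • y) = 0 := by
      have : frobeniusComb p m (u • y) = u ^ p * frobeniusComb p m y := by
        rw [frobeniusComb, Finsupp.sum_of_support_subset _ Finsupp.support_smul _ (by simp [hp]),
          frobeniusComb, Finsupp.sum, Finset.mul_sum]
        exact Finset.sum_congr rfl fun i _ => by simp; ring
      obtain ⟨q, hq⟩ := Nat.exists_eq_succ_of_ne_zero hp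
      rw [this, hq, pow_succ, ← hq, mul_assoc, hur, mul_zero]
    have h4 := h.eq_zero h3
    ext i
    have h5 : φ (u * y i) = 0 := by simpa using congrArg φ (DFunLike.congr_fun h4 i)
    rw [map_mul, hy] at h5
    simpa [hu, hb] using h5
  · intro x
    obtain ⟨a, b, hb, hab⟩ := h1 x
    obtain ⟨y, hy⟩ := h.2 (a * b ^ (p - 1))
    refine ⟨y.mapRange (fun r => (φ b)⁻¹ * φ r) (by simp), ?_⟩
    rw [map_frobeniusComb_smul φ (φ b)⁻¹ y _ (fun i => by simp) Finsupp.support_mapRange hp, hy,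
      map_mul, ← hab, map_pow, mul_assoc, mul_pow_sub_one hp, inv_pow]
    field_simp

end Localize

section Field

variable {p : ℕ} [Fact p.Prime] {ι : Type*}

omit [Fact p.Prime] in
lemma IsFrobeniusBasis.of_isSeparable {M F : Type*} [Field M] [Field F] [Algebra M F]
    [ExpChar M p] [Algebra.IsSeparable M F] {m : ι → M} (h : IsFrobeniusBasis p m) :
    IsFrobeniusBasis p (fun i => algebraMap M F (m i)) := by
  have : ExpChar F p := expChar_of_injective_algebraMap (algebraMap M F).injective p
  let e := Module.Basis.ofVectorSpace M F
  let f := e.mapPowExpCharPowOfIsSeparable p 1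
  rw [h.algebraMap_iff e]
  have hf : (fun j => e j ^ p) = f := by
    ext j; simp [f, Module.Basis.mapPowExpCharPowOfIsSeparable]
  rw [hf, ← Module.Basis.coe_repr_symm]
  exact f.repr.symm.bijective

omit [Fact p.Prime] in
lemma IsFrobeniusBasis.tensorProduct {K E L : Type*} [Field K] [CommRing E] [CommRing L] [Algebra K E]
    [Algebra K L] [ExpChar K p] [ExpChar L p] [ExpChar E p] [ExpChar (E ⊗[K] L) p] {m : ι → K}
    (hK : IsFrobeniusBasis p m) (hE : IsFrobeniusBasis p fun i => algebraMap K E (m i))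
    (hL : IsFrobeniusBasis p fun i => algebraMap K L (m i)) :
    IsFrobeniusBasis p fun i => algebraMap K (E ⊗[K] L) (m i) := by
  let e := Module.Basis.ofVectorSpace K L
  have hb := (hK.algebraMap_iff e).1 hL
  let f : Module.Basis _ K L := .ofRepr (LinearEquiv.ofBijective _ hb).symm
  have hf : ∀ j, f j = e j ^ p := fun j => by
    simp [f]
  have := (hE.algebraMap_iff (e.baseChange E)).2 (by
    have hf' : (fun j => (e.baseChange E) j ^ p) = f.baseChange E := by
      ext j; simp [hf]
    rw [hf', ← Module.Basis.coe_repr_symm]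
    exact (f.baseChange E).repr.symm.bijective)
  simpa only [← IsScalarTower.algebraMap_apply] using this

lemma IsTranscendenceBasis.isAlgebraic_mvPolynomial {K L κ : Type*} [Field K] [Field L]
    [Algebra K L] {x : κ → L} (hx : IsTranscendenceBasis K x) :
    letI : Algebra (MvPolynomial κ K) L := (MvPolynomial.aeval x).toAlgebra
    Algebra.IsAlgebraic (MvPolynomial κ K) L := by
  let _ : Algebra (MvPolynomial κ K) L := (MvPolynomial.aeval x).toAlgebra
  have := hx.isAlgebraic
  refine ⟨fun l => (Algebra.IsAlgebraic.isAlgebraic (R := Algebra.adjoin K (Set.range x))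
    l).ringHom_of_comp_eq hx.1.aevalEquiv.symm (RingHom.id L) hx.1.aevalEquiv.symm.injective ?_⟩
  ext a
  obtain ⟨a, rfl⟩ := hx.1.aevalEquiv.surjective a
  change MvPolynomial.aeval x (hx.1.aevalEquiv.symm (hx.1.aevalEquiv a)) = _
  simp

/-- If `X` is a transcendence basis of `L / K` which is mapped to a family algebraically
independent over `E`, then the kernel of the natural map from `E ⊗[K] L` to the ambient field
vanishes after localization, provided that `E ⊗[K] L` is reduced. -/
lemma exists_mul_eq_zero_of_productMap_eq_zero {K E L Ω κ : Type*}
    [Field K] [Field E] [Field L] [Field Ω]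
    [Algebra K E] [Algebra K L] [Algebra K Ω] [Algebra E Ω] [IsScalarTower K E Ω]
    [IsReduced (E ⊗[K] L)]
    (φ : L →ₐ[K] Ω) {x : κ → L} (hx : IsTranscendenceBasis K x)
    (hφ : AlgebraicIndependent E fun k => φ (x k)) (r : E ⊗[K] L)
    (hr : Algebra.TensorProduct.productMap (IsScalarTower.toAlgHom K E Ω) φ r = 0) :
    ∃ u, Algebra.TensorProduct.productMap (IsScalarTower.toAlgHom K E Ω) φ u ≠ 0 ∧ u * r = 0 := by
  set Φ := Algebra.TensorProduct.productMap (IsScalarTower.toAlgHom K E Ω) φ with hΦ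
  let α : MvPolynomial κ E →ₐ[E] E ⊗[K] L := MvPolynomial.aeval fun k => (1 : E) ⊗ₜ[K] x k
  let _ : Algebra (MvPolynomial κ E) (E ⊗[K] L) := α.toRingHom.toAlgebra
  have hαΦ : ∀ f, Φ (α f) = MvPolynomial.aeval (fun k => φ (x k)) f := by
    intro f
    induction f using MvPolynomial.induction_on with
    | C a => simp [α, hΦ, Algebra.TensorProduct.algebraMap_apply]
    | add f g hf hg => simp [hf, hg]
    | mul_X f k hf => rw [map_mul, map_mul, hf]; simp [α, hΦ]
  have halg : IsAlgebraic (MvPolynomial κ E) r := by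
    clear hr
    induction r using TensorProduct.induction_on with
    | zero => exact isAlgebraic_zero
    | add a b ha hb => exact ha.add hb
    | tmul a l =>
      have h1 : IsAlgebraic (MvPolynomial κ E) (a ⊗ₜ[K] (1 : L)) := by
        have h2 : a ⊗ₜ[K] (1 : L) =
            algebraMap (MvPolynomial κ E) (E ⊗[K] L) (MvPolynomial.C a) := by
          change _ = α _
          simp [α, Algebra.TensorProduct.algebraMap_apply]
        rw [h2]
        exact isAlgebraic_algebraMap _
      have h3 : IsAlgebraic (MvPolynomial κ E) ((1 : E) ⊗ₜ[K] l) := by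
        let _ : Algebra (MvPolynomial κ K) L := (MvPolynomial.aeval x).toAlgebra
        refine (hx.isAlgebraic_mvPolynomial.isAlgebraic l).ringHom_of_comp_eq
          (MvPolynomial.map (algebraMap K E))
          (Algebra.TensorProduct.includeRight : L →ₐ[K] E ⊗[K] L)
          (MvPolynomial.map_injective _ (algebraMap K E).injective) ?_
        ext k
        · change α _ = _ ⊗ₜ[K] MvPolynomial.aeval x _
          simp only [RingHom.coe_coe, MvPolynomial.map_C, MvPolynomial.algHom_C,
            Algebra.TensorProduct.algebraMap_apply, α]
          simp [Algebra.algebraMap_eq_smul_one, TensorProduct.smul_tmul]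
        · change α _ = _ ⊗ₜ[K] MvPolynomial.aeval x _
          simp [α]
      simpa using h1.mul h3
  obtain ⟨f, hf0, hf⟩ := halg
  obtain ⟨q, hq, hdvd⟩ := Polynomial.exists_eq_pow_rootMultiplicity_mul_and_not_dvd f hf0 0
  rw [map_zero, sub_zero] at hq hdvd
  refine ⟨Polynomial.aeval r q, ?_, ?_⟩
  · rw [← q.divX_mul_X_add, map_add, map_add, map_mul, map_mul, Polynomial.aeval_X, hr, mul_zero,
      zero_add, Polynomial.aeval_C]
    change Φ (α _) ≠ 0
    rw [hαΦ]
    exact fun h => hdvd (Polynomial.X_dvd_iff.2 (hφ (h.trans (map_zero _).symm)))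
  · refine IsReduced.eq_zero _ ⟨f.rootMultiplicity 0 + 1, ?_⟩
    rw [hq, map_mul, map_pow, Polynomial.aeval_X] at hf
    rw [mul_pow, pow_succ, pow_succ]
    linear_combination Polynomial.aeval r q ^ (f.rootMultiplicity 0) * r * hf

lemma IsFrobeniusBasis.sup_fieldRange [Nonempty ι] {K L Ω κ : Type*} [Field K] [Field L] [Field Ω]
    [Algebra K L] [Algebra K Ω] [ExpChar K p] {m : ι → K} (hK : IsFrobeniusBasis p m)
    (hL : IsFrobeniusBasis p fun i => algebraMap K L (m i)) {x : κ → L}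
    (hx : IsTranscendenceBasis K x) (E : IntermediateField K Ω)
    (hE : IsFrobeniusBasis p fun i => algebraMap K E (m i)) (φ : L →ₐ[K] Ω)
    (hφ : AlgebraicIndependent E fun k => φ (x k)) :
    IsFrobeniusBasis p fun i => algebraMap K ↥(E ⊔ φ.fieldRange) (m i) := by
  have : ExpChar L p := expChar_of_injective_algebraMap (algebraMap K L).injective p
  have : ExpChar E p := expChar_of_injective_algebraMap (algebraMap K E).injective p
  have : ExpChar ↥(E ⊔ φ.fieldRange) p :=
    expChar_of_injective_algebraMap (algebraMap K ↥(E ⊔ φ.fieldRange)).injective p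
  have : ExpChar (E ⊗[K] L) p :=
    expChar_of_injective_algebraMap (algebraMap K (E ⊗[K] L)).injective p
  have hT := hK.tensorProduct hE hL
  have := hT.isReduced
  let Φ := Algebra.TensorProduct.productMap (IsScalarTower.toAlgHom K E Ω) φ
  have hΦ : ∀ r, Φ r ∈ E ⊔ φ.fieldRange := by
    intro r
    induction r using TensorProduct.induction_on with
    | zero => simp
    | add a b ha hb => rw [map_add]; exact add_mem ha hb
    | tmul a l =>
      rw [Algebra.TensorProduct.productMap_apply_tmul]
      exact mul_mem ((le_sup_left : E ≤ _) a.2) ((le_sup_right : φ.fieldRange ≤ _) ⟨l, rfl⟩)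
  let Ψ : E ⊗[K] L →ₐ[K] ↥(E ⊔ φ.fieldRange) :=
    Φ.codRestrict (E ⊔ φ.fieldRange).toSubalgebra hΦ
  have hΨ : ∀ r, ((Ψ r : ↥(E ⊔ φ.fieldRange)) : Ω) = Φ r := fun r => rfl
  have hΨ0 : ∀ r, Ψ r = 0 ↔ Φ r = 0 := fun r => by rw [← hΨ, ZeroMemClass.coe_eq_zero]
  have := hT.map_field Ψ.toRingHom ?_ ?_
  · convert this using 2 with i
    exact (Ψ.commutes (m i)).symm
  · rintro ⟨x, hx⟩
    have hle : Algebra.adjoin K ((E : Set Ω) ∪ φ.fieldRange) ≤ Φ.range := by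
      rw [Algebra.adjoin_le_iff]
      rintro y (hy | ⟨l, rfl⟩)
      · exact ⟨⟨y, hy⟩ ⊗ₜ 1, by simp [Φ]⟩
      · exact ⟨1 ⊗ₜ l, by simp [Φ]⟩
    obtain ⟨r, hr, s, hs, hrs⟩ := IntermediateField.mem_adjoin_iff_div.1 hx
    obtain ⟨a, rfl⟩ := hle hr
    obtain ⟨b, rfl⟩ := hle hs
    by_cases hb : Φ b = 0
    · refine ⟨0, 1, by rw [map_one]; exact one_ne_zero, Subtype.ext ?_⟩
      simp only [map_one, map_zero, mul_one, ZeroMemClass.coe_zero]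
      rw [hrs]
      exact (congrArg _ hb).trans (div_zero _)
    · refine ⟨a, b, fun h => hb ((hΨ0 b).1 h), Subtype.ext ?_⟩
      change x * Φ b = Φ a
      rw [hrs]
      exact div_mul_cancel₀ _ hb
  · intro r hr
    obtain ⟨u, hu, hur⟩ := exists_mul_eq_zero_of_productMap_eq_zero φ hx hφ r ((hΨ0 r).1 hr)
    exact ⟨u, fun h => hu ((hΨ0 u).1 h), hur⟩

end Field

section Compositum

variable {p : ℕ} [Fact p.Prime] {ι : Type*}
variable {K L Ω κ α : Type*} [Field K] [Field L] [Field Ω] [Algebra K L] [Algebra K Ω]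

lemma IsFrobeniusBasis.of_directed [ExpChar K p] {m : ι → K} {E : α → IntermediateField K Ω}
    (hdir : Directed (· ≤ ·) E) [Nonempty α]
    (hE : ∀ a, IsFrobeniusBasis p fun i => algebraMap K (E a) (m i))
    {T : IntermediateField K Ω} (hle : ∀ a, E a ≤ T) (hT : ∀ x ∈ T, ∃ a, x ∈ E a) :
    IsFrobeniusBasis p fun i => algebraMap K T (m i) := by
  have hp : p ≠ 0 := (Fact.out : p.Prime).ne_zero
  have : ExpChar T p := expChar_of_injective_algebraMap (algebraMap K T).injective p
  have key : ∀ a (y : ι →₀ E a) (z : ι →₀ T), (∀ i, (z i : Ω) = y i) →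
      frobeniusComb p (fun i => algebraMap K T (m i)) z =
        IntermediateField.inclusion (hle a)
          (frobeniusComb p (fun i => algebraMap K (E a) (m i)) y) := by
    intro a y z h
    have := map_frobeniusComb_smul (m := fun i => algebraMap K (E a) (m i))
      (IntermediateField.inclusion (hle a)).toRingHom 1 y z
      (fun i => by rw [one_mul]; exact Subtype.ext (h i)) (fun i hi => by
        simp only [Finsupp.mem_support_iff] at *
        intro h0
        exact hi (Subtype.ext (by rw [h, h0]; rfl))) hp
    rw [one_pow, one_mul] at this
    exact this
  apply isFrobeniusBasis_of
  · intro z hz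
    obtain ⟨a, ha⟩ : ∃ a, ∀ i, (z i : Ω) ∈ E a := by
      choose f hf using fun i => hT (z i) (z i).2
      classical
      obtain ⟨a, ha⟩ := hdir.finset_le (z.support.image f)
      refine ⟨a, fun i => ?_⟩
      by_cases hi : i ∈ z.support
      · exact ha _ (Finset.mem_image_of_mem f hi) (hf i)
      · rw [Finsupp.notMem_support_iff.1 hi]; exact zero_mem _
    let y : ι →₀ E a := Finsupp.onFinset z.support (fun i => ⟨z i, ha i⟩) (fun i hi => by
      rw [Finsupp.mem_support_iff]
      intro h0
      have h1 : (z i : Ω) = 0 := congrArg Subtype.val h0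
      exact hi (Subtype.ext h1))
    rw [key a y z (fun i => rfl)] at hz
    have : ExpChar (E a) p := expChar_of_injective_algebraMap (algebraMap K (E a)).injective p
    have hy := (hE a).eq_zero ((map_eq_zero_iff _ (RingHom.injective _)).1 hz)
    ext i
    have hyi : (y i : Ω) = 0 := congrArg Subtype.val (DFunLike.congr_fun hy i)
    exact hyi
  · rintro ⟨x, hx⟩
    obtain ⟨a, ha⟩ := hT x hx
    obtain ⟨y, hy⟩ := (hE a).2 ⟨x, ha⟩
    refine ⟨y.mapRange (IntermediateField.inclusion (hle a)) (map_zero _), ?_⟩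
    rw [key a y _ (fun i => by simp), hy]
    rfl

lemma algebraicIndependent_sup_fieldRange (φ : α → L →ₐ[K] Ω) {x : κ → L}
    (hx : IsTranscendenceBasis K x)
    (hφ : AlgebraicIndependent K fun jk : α × κ => φ jk.1 (x jk.2)) {S : Finset α} {n : α}
    (hn : n ∉ S) :
    AlgebraicIndependent ↥(S.sup fun n => (φ n).fieldRange) fun k => φ n (x k) := by
  let z : S × κ → Ω := fun jk => φ jk.1 (x jk.2)
  have h1 : AlgebraicIndependent K (Sum.elim (fun k => φ n (x k)) z) := by
    have := hφ.comp (Sum.elim (fun k => (n, k)) fun jk : S × κ => ((jk.1 : α), jk.2)) (by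
      rintro (k | ⟨⟨j, hj⟩, k⟩) (k' | ⟨⟨j', hj'⟩, k'⟩) h
      · simpa using h
      · simp at h; exact (hn (h.1 ▸ hj')).elim
      · simp at h; exact (hn (h.1 ▸ hj)).elim
      · simpa using h)
    convert this using 1
    ext (k | jk) <;> rfl
  have h2 := (AlgebraicIndependent.sumElim_iff.1 h1).2
  have h3 := IntermediateField.algebraicIndependent_adjoin_iff.2 h2
  have h4 := h3.algebraicClosure
  have hle : (S.sup fun n => (φ n).fieldRange) ≤
      (algebraicClosure (IntermediateField.adjoin K (Set.range z)) Ω).restrictScalars K := by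
    refine Finset.sup_le fun j hj => ?_
    rintro _ ⟨l, rfl⟩
    rw [IntermediateField.mem_restrictScalars, mem_algebraicClosure_iff]
    have hmem : ∀ a : Algebra.adjoin K (Set.range x),
        φ j a ∈ (IntermediateField.adjoin K (Set.range z)).toSubalgebra := by
      have : Algebra.adjoin K (Set.range x) ≤
          (IntermediateField.adjoin K (Set.range z)).toSubalgebra.comap (φ j) := by
        refine Algebra.adjoin_le ?_
        rintro _ ⟨k, rfl⟩
        exact IntermediateField.subset_adjoin _ _ ⟨(⟨j, hj⟩, k), rfl⟩
      exact fun a => this a.2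
    have := hx.isAlgebraic
    let f : Algebra.adjoin K (Set.range x) →ₐ[K] IntermediateField.adjoin K (Set.range z) :=
      ((φ j).comp (Subalgebra.val _)).codRestrict _ hmem
    refine (Algebra.IsAlgebraic.isAlgebraic (R := Algebra.adjoin K (Set.range x))
      l).ringHom_of_comp_eq f (φ j) ?_ rfl
    exact fun a b hab => Subtype.ext ((φ j).injective (congrArg Subtype.val hab))
  exact h4.of_ringHom_of_comp_eq (IntermediateField.inclusion hle) (RingHom.id Ω)
    (RingHom.injective _) rfl

lemma IsFrobeniusBasis.iSup_fieldRange [ExpChar K p] [Nonempty ι] {m : ι → K}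
    (hK : IsFrobeniusBasis p m) (hL : IsFrobeniusBasis p fun i => algebraMap K L (m i))
    {x : κ → L} (hx : IsTranscendenceBasis K x) (φ : α → L →ₐ[K] Ω)
    (hφ : AlgebraicIndependent K fun jk : α × κ => φ jk.1 (x jk.2)) :
    IsFrobeniusBasis p fun i => algebraMap K ↥(⨆ n, (φ n).fieldRange) (m i) := by
  classical
  refine IsFrobeniusBasis.of_directed (E := fun S : Finset α => S.sup fun n => (φ n).fieldRange)
    (directed_of_isDirected_le fun S T h => Finset.sup_mono h) (fun S => ?_)
    (fun S => Finset.sup_le fun n _ => le_iSup (fun n => (φ n).fieldRange) n) fun y hy => ?_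
  · induction S using Finset.induction with
    | empty =>
      rw [Finset.sup_empty]
      have : ExpChar (⊥ : IntermediateField K Ω) p :=
        expChar_of_injective_algebraMap (algebraMap K _).injective p
      refine hK.map_field (algebraMap K (⊥ : IntermediateField K Ω)) ?_ ?_
      · rintro ⟨y, hy⟩
        obtain ⟨a, rfl⟩ := IntermediateField.mem_bot.1 hy
        exact ⟨a, 1, by simp, by simp; rfl⟩
      · intro r hr
        exact ⟨1, by simp, by simpa using hr⟩
    | insert n S hn ih =>
      rw [Finset.sup_insert, sup_comm]
      exact hK.sup_fieldRange hL hx _ ih (φ n) (algebraicIndependent_sup_fieldRange φ hx hφ hn)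
  · obtain ⟨S, hS⟩ := IntermediateField.exists_finset_of_mem_iSup hy
    exact ⟨S, by rwa [Finset.sup_eq_iSup]⟩

end Compositum

lemma exists_algHom_of_isTranscendenceBasis {K L Ω κ : Type*} [Field K] [Field L] [Field Ω]
    [Algebra K L] [Algebra K Ω] [IsAlgClosed Ω] {x : κ → L} (hx : IsTranscendenceBasis K x)
    {z : κ → Ω} (hz : AlgebraicIndependent K z) : ∃ φ : L →ₐ[K] Ω, ∀ k, φ (x k) = z k := by
  let _ : Algebra (MvPolynomial κ K) L := (MvPolynomial.aeval x).toAlgebra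
  let _ : Algebra (MvPolynomial κ K) Ω := (MvPolynomial.aeval z).toAlgebra
  have : Algebra.IsAlgebraic (MvPolynomial κ K) L := hx.isAlgebraic_mvPolynomial
  have : FaithfulSMul (MvPolynomial κ K) L := (faithfulSMul_iff_algebraMap_injective _ _).2 hx.1
  have : FaithfulSMul (MvPolynomial κ K) Ω := (faithfulSMul_iff_algebraMap_injective _ _).2 hz
  have hL : IsScalarTower K (MvPolynomial κ K) L :=
    .of_algebraMap_eq fun r => ((MvPolynomial.aeval x).commutes r).symm
  have hΩ : IsScalarTower K (MvPolynomial κ K) Ω :=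
    .of_algebraMap_eq fun r => ((MvPolynomial.aeval z).commutes r).symm
  let φ : L →ₐ[MvPolynomial κ K] Ω := IsAlgClosed.lift
  refine ⟨φ.restrictScalars K, fun k => ?_⟩
  have h := φ.commutes (MvPolynomial.X k)
  rwa [show algebraMap (MvPolynomial κ K) L (.X k) = x k from MvPolynomial.aeval_X x k,
    show algebraMap (MvPolynomial κ K) Ω (.X k) = z k from MvPolynomial.aeval_X z k] at h

lemma exists_algEquiv_of_isTranscendenceBasis {K Ω J : Type*} [Field K] [Field Ω]
    [Algebra K Ω] [IsAlgClosed Ω] {z : J → Ω} (hz : IsTranscendenceBasis K z) (e : J ≃ J) :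
    ∃ s : Ω ≃ₐ[K] Ω, ∀ j, s (z j) = z (e j) := by
  let _ : Algebra (MvPolynomial J K) Ω := (MvPolynomial.aeval z).toAlgebra
  have : Algebra.IsAlgebraic (MvPolynomial J K) Ω := hz.isAlgebraic_mvPolynomial
  have : FaithfulSMul (MvPolynomial J K) Ω := (faithfulSMul_iff_algebraMap_injective _ _).2 hz.1
  have : IsAlgClosure (MvPolynomial J K) Ω := ⟨inferInstance, inferInstance⟩
  let s := IsAlgClosure.equivOfEquiv Ω Ω (MvPolynomial.renameEquiv K e).toRingEquiv
  have hs : ∀ f, s (MvPolynomial.aeval z f) = MvPolynomial.aeval z (MvPolynomial.rename e f) :=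
    IsAlgClosure.equivOfEquiv_algebraMap Ω Ω (MvPolynomial.renameEquiv K e).toRingEquiv
  refine ⟨AlgEquiv.ofRingEquiv (f := s) fun r => ?_, fun j => ?_⟩
  · simpa using hs (.C r)
  · simpa using hs (.X j)

lemma exists_isAlgClosed_isTranscendenceBasis (K J : Type u) [Field K] :
    ∃ (Ω : Type u) (_ : Field Ω) (_ : Algebra K Ω) (z : J → Ω),
      IsAlgClosed Ω ∧ IsTranscendenceBasis K z := by
  refine ⟨AlgebraicClosure (FractionRing (MvPolynomial J K)), inferInstance, inferInstance,
    fun j => algebraMap (MvPolynomial J K) _ (MvPolynomial.X j), inferInstance, ?_⟩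
  have : Algebra.IsAlgebraic (MvPolynomial J K)
      (AlgebraicClosure (FractionRing (MvPolynomial J K))) :=
    (IsFractionRing.comap_isAlgebraic_iff (K := FractionRing (MvPolynomial J K))).2 inferInstance
  have : FaithfulSMul (MvPolynomial J K) (AlgebraicClosure (FractionRing (MvPolynomial J K))) :=
    .trans _ (FractionRing (MvPolynomial J K)) _
  exact (IsTranscendenceBasis.mvPolynomial J K).algebraMap_comp

lemma mem_separableClosure_of_map_mem {K Ω : Type*} [Field K] [Field Ω] [Algebra K Ω]
    {E : IntermediateField K Ω} {s : Ω →ₐ[K] Ω} (hs : ∀ y ∈ E, s y ∈ E) {y : Ω}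
    (hy : y ∈ separableClosure E Ω) : s y ∈ separableClosure E Ω := by
  rw [mem_separableClosure_iff] at *
  let f : E →ₐ[K] E := (s.comp E.val).codRestrict E.toSubalgebra fun a => hs a a.2
  have hf : (algebraMap E Ω).comp f.toRingHom = (s : Ω →+* Ω).comp (algebraMap E Ω) := rfl
  refine Polynomial.Separable.of_dvd (Polynomial.Separable.map (f := f.toRingHom) hy)
    (minpoly.dvd E _ ?_)
  rw [Polynomial.aeval_def, Polynomial.eval₂_map, hf, ← RingHom.coe_coe s, ← Polynomial.hom_eval₂,
    ← Polynomial.aeval_def, minpoly.aeval, map_zero]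

lemma exists_isSepClosed_infinite_orbit {p : ℕ} [Fact p.Prime] {K L : Type v} [Field K] [Field L]
    [Algebra K L] [ExpChar K p] {ι : Type*} [Nonempty ι] {m : ι → K} (hK : IsFrobeniusBasis p m)
    (hL : IsFrobeniusBasis p fun i => algebraMap K L (m i)) {c : L} (hc : Transcendental K c) :
    ∃ (F : Type v) (_ : Field F) (j : L →+* F), IsSepClosed F ∧
      (IsFrobeniusBasis p fun i => j (algebraMap K L (m i))) ∧
      {y : F | ∃ σ : F ≃+* F,
        (∀ x : K, σ (j (algebraMap K L x)) = j (algebraMap K L x)) ∧ y = σ (j c)}.Infinite := by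
  obtain ⟨X, hcX, hX⟩ := exists_isTranscendenceBasis_superset (R := K) (s := {c})
    (algebraicIndependent_singleton_iff (⟨c, rfl⟩ : ({c} : Set L)) |>.2 hc)
  obtain ⟨Ω, _, _, z, _, hz⟩ := exists_isAlgClosed_isTranscendenceBasis K (ℤ × X)
  obtain ⟨φ₀, hφ₀⟩ := exists_algHom_of_isTranscendenceBasis hX
    (hz.1.comp (fun k => ((0 : ℤ), k)) fun k k' h => by simpa using h)
  obtain ⟨s, hs⟩ := exists_algEquiv_of_isTranscendenceBasis hz
    ((Equiv.addRight (1 : ℤ)).prodCongr (Equiv.refl X))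
  have hsz : ∀ (n l : ℤ) (k : X), (s ^ n) (z (l, k)) = z (l + n, k) := by
    intro n
    induction n with
    | zero => simp
    | succ n ih =>
      intro l k
      rw [zpow_add_one, AlgEquiv.mul_apply, hs]
      exact (ih _ _).trans (congrArg (fun a => z (a, k)) (by
        change l + 1 + (n : ℤ) = _
        ring))
    | pred n ih =>
      intro l k
      have h : s⁻¹ (z (l, k)) = z (l - 1, k) := by
        rw [AlgEquiv.aut_inv, AlgEquiv.symm_apply_eq, hs]
        simp
      rw [zpow_sub_one, AlgEquiv.mul_apply, h, ih]
      congr 2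
      ring
  let φ : ℤ → L →ₐ[K] Ω := fun n => (s ^ n).toAlgHom.comp φ₀
  have hφ : ∀ n k, φ n k = (s ^ n) (φ₀ k) := fun _ _ => rfl
  have hφz : ∀ n (k : X), φ n k = z (n, k) := fun n k => by
    rw [hφ, hφ₀]
    simp [hsz]
  let E := ⨆ n, (φ n).fieldRange
  have hE : IsFrobeniusBasis p fun i => algebraMap K E (m i) :=
    hK.iSup_fieldRange hL hX φ (by simpa only [hφz] using hz.1)
  have hsE : ∀ n : ℤ, ∀ y ∈ E, (s ^ n) y ∈ E := by
    intro n
    suffices E ≤ E.comap (s ^ n).toAlgHom from this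
    refine iSup_le fun l => ?_
    rintro _ ⟨y, rfl⟩
    refine le_iSup (fun n => (φ n).fieldRange) (n + l) ⟨y, ?_⟩
    change (s ^ (n + l)) (φ₀ y) = (s ^ n) ((s ^ l) (φ₀ y))
    rw [zpow_add, AlgEquiv.mul_apply]
  let F := separableClosure E Ω
  have hsF : ∀ n : ℤ, ∀ y ∈ F, (s ^ n) y ∈ F := fun n y hy =>
    mem_separableClosure_of_map_mem (s := (s ^ n).toAlgHom) (hsE n) hy
  have hcancel : ∀ (n : ℤ) (y : Ω), (s ^ n) ((s ^ (-n)) y) = y := fun n y => by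
    rw [← AlgEquiv.mul_apply, ← zpow_add, add_neg_cancel, zpow_zero, AlgEquiv.one_apply]
  let σ : ℤ → F ≃+* F := fun n =>
    { toFun := fun y => ⟨(s ^ n) y, hsF n y y.2⟩
      invFun := fun y => ⟨(s ^ (-n)) y, hsF (-n) y y.2⟩
      left_inv := fun y => Subtype.ext (by simpa only [neg_neg] using hcancel (-n) y)
      right_inv := fun y => Subtype.ext (hcancel n y)
      map_mul' := fun y y' => Subtype.ext (map_mul (s ^ n) _ _)
      map_add' := fun y y' => Subtype.ext (map_add (s ^ n) _ _) }
  have hjE : ∀ l, φ 0 l ∈ E := fun l => le_iSup (fun n => (φ n).fieldRange) 0 ⟨l, rfl⟩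
  let j : L →+* F := (algebraMap E F).comp ((φ 0).toRingHom.codRestrict E.toSubring hjE)
  have hjK : ∀ x, j (algebraMap K L x) = algebraMap E F (algebraMap K E x) := fun x =>
    Subtype.ext ((φ 0).commutes x)
  have : ExpChar E p := expChar_of_injective_algebraMap (algebraMap K E).injective p
  refine ⟨F, inferInstance, j, (separableClosure.isSepClosure E Ω).sep_closed, ?_, ?_⟩
  · simpa only [hjK] using hE.of_isSeparable (F := F)
  · refine Set.infinite_of_injective_forall_mem (f := fun n : ℤ => σ n (j c)) (fun n n' h => ?_)
      fun n => ⟨σ n, fun x => ?_, rfl⟩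
    · have h : (s ^ n) (φ 0 c) = (s ^ n') (φ 0 c) := congrArg Subtype.val h
      rw [hφz 0 ⟨c, hcX rfl⟩, hsz, hsz] at h
      simpa using hz.1.injective h
    · rw [hjK]
      exact Subtype.ext ((s ^ n).commutes x)

lemma isFrobeniusBasis_iff {p : ℕ} [Fact p.Prime] {F ι : Type*} [Field F] [ExpChar F p]
    (w : ι → F) : IsFrobeniusBasis p w ↔
      LinearIndependent (Subfield.closure (Set.range fun x : F => x ^ p)) w ∧
        Submodule.span (Subfield.closure (Set.range fun x : F => x ^ p)) (Set.range w) = ⊤ := by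
  have hcl : Subfield.closure (Set.range fun x : F => x ^ p) = (frobenius F p).fieldRange :=
    Subfield.closure_eq (frobenius F p).fieldRange
  rw [hcl]
  let e : F ≃+ (frobenius F p).fieldRange :=
    AddEquiv.ofBijective (frobenius F p).rangeRestrictField
      ⟨RingHom.injective _, (frobenius F p).rangeRestrictField_bijective.2⟩
  have hcomb : frobeniusComb p w =
      Finsupp.linearCombination (frobenius F p).fieldRange w ∘ Finsupp.mapRange.addEquiv e := by
    ext y
    rw [Function.comp_apply, Finsupp.linearCombination_apply, Finsupp.mapRange.addEquiv_apply,
      Finsupp.sum_mapRange_index (by simp)]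
    rfl
  rw [IsFrobeniusBasis, hcomb, EquivLike.bijective_comp, Function.Bijective, LinearIndependent,
    ← LinearMap.range_eq_top, Finsupp.range_linearCombination]

lemma isPBasis_image_iff {p : ℕ} [Fact p.Prime] {K F : Type*} [Field K] [Field F] [ExpChar F p]
    (g : K →+* F) (B : Set K) : IsPBasis p F (g '' B) ↔
      IsFrobeniusBasis p fun f : {f : B →₀ ℕ // ∀ b, f b < p} =>
        g ((f : B →₀ ℕ).prod fun b e => (b : K) ^ e) := by
  let e : {f : B →₀ ℕ // ∀ b, f b < p} ≃ {f : g '' B →₀ ℕ // ∀ b, f b < p} :=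
    (Finsupp.equivCongrLeft (Equiv.Set.image g B g.injective)).subtypeEquiv fun f =>
      (Equiv.Set.image g B g.injective).forall_congr fun b => by simp
  have he : (fun f : {f : B →₀ ℕ // ∀ b, f b < p} => g ((f : B →₀ ℕ).prod fun b e => (b : K) ^ e)) =
      (fun f : {f : g '' B →₀ ℕ // ∀ b, f b < p} =>
        (f : g '' B →₀ ℕ).prod fun b e => (b : F) ^ e) ∘ e := by
    ext f
    simp only [Function.comp_apply, e, Equiv.subtypeEquiv_apply, Finsupp.equivCongrLeft_apply]
    rw [Finsupp.prod_equivMapDomain,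
      map_finsuppProd]
    simp
  rw [he, isFrobeniusBasis_iff, linearIndependent_equiv, EquivLike.range_comp]
  rfl

/-- Let `p` be a prime, let `K ⊆ L` be fields of characteristic `p`
(the inclusion encoded by an embedding `i : K →+* L`), and let `B` be a subset of `K`
that is simultaneously a `p`-basis of `K` and a `p`-basis of `L`.  Suppose `c ∈ L` is not
algebraic over `K`.  Then there is a field extension `F` of `L` such that `F` is separably
closed, `B` is a `p`-basis of `F`, and the orbit of `c` under the group `Aut(F/K)` of field
automorphisms of `F` fixing `K` pointwise is infinite. -/
theorem stmt_5 (p : ℕ) [Fact p.Prime] (K : Type u) (L : Type v) [Field K] [Field L]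
    [CharP K p] [CharP L p] (i : K →+* L) (B : Set K)
    (hBK : IsPBasis p K B) (hBL : IsPBasis p L (i '' B))
    (c : L) (hc : ∀ f : Polynomial K, f ≠ 0 → Polynomial.eval₂ i c f ≠ 0) :
    ∃ (F : Type v) (_ : Field F) (j : L →+* F),
      IsSepClosed F ∧
      IsPBasis p F (j '' (i '' B)) ∧
      {y : F | ∃ σ : F ≃+* F, (∀ x : K, σ (j (i x)) = j (i x)) ∧ y = σ (j c)}.Infinite := by
  have hp : p.Prime := Fact.out
  have : ExpChar K p := .prime hp
  have : ExpChar L p := .prime hp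
  have : Nonempty {f : B →₀ ℕ // ∀ b, f b < p} := ⟨0, fun _ => hp.pos⟩
  have : ExpChar i.fieldRange p :=
    expChar_of_injective_ringHom i.rangeRestrictField.injective p
  have hK : IsFrobeniusBasis p fun f : {f : B →₀ ℕ // ∀ b, f b < p} =>
      (f : B →₀ ℕ).prod fun b e => (b : K) ^ e := by
    simpa using (isPBasis_image_iff (.id K) B).1 (by simpa using hBK)
  have hi := i.rangeRestrictField_bijective.2
  obtain ⟨F, _, j, hF, hj, hinf⟩ := exists_isSepClosed_infinite_orbit (c := c)
    (hK.map_field i.rangeRestrictField (fun x => by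
      obtain ⟨a, rfl⟩ := hi x
      exact ⟨a, 1, by simp⟩) fun r hr => ⟨1, by simpa using hr⟩)
    ((isPBasis_image_iff i B).1 hBL) fun ⟨f, hf, hfc⟩ => by
      obtain ⟨g, rfl⟩ := Polynomial.map_surjective _ hi f
      refine hc g (by rintro rfl; simp at hf) ?_
      rwa [Polynomial.aeval_def, Polynomial.eval₂_map] at hfc
  have : ExpChar F p := expChar_of_injective_ringHom j.injective p
  refine ⟨F, inferInstance, j, hF, ?_, hinf.mono ?_⟩
  · rw [← Set.image_comp]
    exact (isPBasis_image_iff (j.comp i) B).2 hj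
  · rintro y ⟨σ, hσ, rfl⟩
    exact ⟨σ, fun x => hσ (i.rangeRestrictField x), rfl⟩
end
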